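/- For every ε > 0 there exists a constant C(ε) > 0 such that for every integer q ≥ 3, |Σ_{χ ≠ χ0, χ(−1)=1} |L(1,χ)|^{−2} − (ζ(2)/(2ζ(4))) · ∏_{p | q} (1 + p^{−2})^{−1} · φ(q)| ≤ C(ε) · q^{ε}. -/

import Mathlib

open Complex DirichletCharacter


namespace NSM
open Filter Topology

/-- partial sums of a character over `range n` -/
lemma char_sum_range_norm_le {q : ℕ} [NeZero q] (χ : DirichletCharacter ℂ q) (hχ : χ ≠ 1) (n : ℕ) :
    ‖∑ k ∈ Finset.range n, χ (k : ZMod q)‖ ≤ q := by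
  have hper : ∀ m : ℕ, ∑ k ∈ Finset.range q, χ ((m * q + k : ℕ) : ZMod q) = 0 := by
    intro m
    have h0 : ∑ a : ZMod q, χ a = 0 := MulChar.sum_eq_zero_of_ne_one hχ
    rw [← h0]
    refine Finset.sum_bij (fun k _ => ((k : ℕ) : ZMod q)) (by simp) ?_ ?_ ?_
    · intro a ha b hb hab
      simp only [Finset.mem_range] at ha hb
      have := (ZMod.natCast_eq_natCast_iff' a b q).1 hab
      rwa [Nat.mod_eq_of_lt ha, Nat.mod_eq_of_lt hb] at this
    · intro b _
      exact ⟨b.val, by simp [ZMod.val_lt], by simp⟩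
    · intro a _
      simp
  have hblk : ∀ m : ℕ, ∑ k ∈ Finset.range (m * q), χ (k : ZMod q) = 0 := by
    intro m
    induction m with
    | zero => simp
    | succ m ih =>
      rw [Nat.succ_mul, Finset.sum_range_add, ih, hper m, zero_add]
  have hn : n = n / q * q + n % q := (Nat.div_add_mod' n q).symm
  rw [hn, Finset.sum_range_add, hblk, zero_add]
  calc ‖∑ x ∈ Finset.range (n % q), χ ((n / q * q + x : ℕ) : ZMod q)‖
      ≤ ∑ x ∈ Finset.range (n % q), (1 : ℝ) :=
        norm_sum_le_of_le _ fun i _ => DirichletCharacter.norm_le_one χ _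
    _ = (n % q : ℕ) := by simp
    _ ≤ q := by exact_mod_cast (Nat.mod_lt n (Nat.pos_of_ne_zero (NeZero.ne q))).le

lemma cpow_diff_norm_le {s : ℂ} (hs : 0 < s.re) {n : ℕ} (hn : 1 ≤ n) :
    ‖((n + 1 : ℕ) : ℂ) ^ (-s) - (n : ℂ) ^ (-s)‖ ≤
      ‖s‖ / s.re * ((n : ℝ) ^ (-s.re) - ((n + 1 : ℕ) : ℝ) ^ (-s.re)) := by
  have hn0 : (0 : ℝ) < n := by exact_mod_cast hn
  have key := image_norm_le_of_norm_deriv_right_le_deriv_boundary'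
    (f := fun x : ℝ => (x : ℂ) ^ (-s) - (n : ℂ) ^ (-s)) (f' := fun x : ℝ => -s * (x : ℂ) ^ (-s - 1))
    (a := (n : ℝ)) (b := ((n + 1 : ℕ) : ℝ))
    (B := fun x : ℝ => ‖s‖ / s.re * ((n : ℝ) ^ (-s.re) - x ^ (-s.re)))
    (B' := fun x : ℝ => ‖s‖ * x ^ (-s.re - 1))
    ?_ ?_ ?_ ?_ ?_ ?_ (x := ((n + 1 : ℕ) : ℝ)) ?_
  · simpa using key
  · intro x hx
    have hx0 : 0 < x := lt_of_lt_of_le hn0 hx.1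
    refine ContinuousAt.continuousWithinAt ?_
    have h1 : ContinuousAt (fun x : ℝ => (x : ℂ) ^ (-s)) x :=
      continuousAt_ofReal_cpow_const _ _ (Or.inr hx0.ne')
    exact h1.sub continuousAt_const
  · intro x hx
    have hx0 : 0 < x := lt_of_lt_of_le hn0 hx.1
    have h1 : HasDerivAt (fun x : ℂ => x ^ (-s)) (-s * (x : ℂ) ^ (-s - 1)) (x : ℂ) := by
      simpa using (hasDerivAt_id (x : ℂ)).cpow_const (c := -s) (Or.inl (by simpa using hx0))
    exact (h1.comp_ofReal.sub_const _).hasDerivWithinAt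
  · simp
  · intro x hx
    have hx0 : 0 < x := lt_of_lt_of_le hn0 hx.1
    refine ContinuousAt.continuousWithinAt ?_
    exact continuousAt_const.mul (continuousAt_const.sub
      (Real.continuousAt_rpow_const _ _ (Or.inl hx0.ne')))
  · intro x hx
    have hx0 : 0 < x := lt_of_lt_of_le hn0 hx.1
    have h1 := (Real.hasDerivAt_rpow_const (p := -s.re) (Or.inl hx0.ne'))
    have h2 := ((h1.const_sub ((n : ℝ) ^ (-s.re))).const_mul (‖s‖ / s.re)).hasDerivWithinAt
      (s := Set.Ici x)
    refine h2.congr_deriv ?_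
    field_simp
  · intro x hx
    have hx0 : 0 < x := lt_of_lt_of_le hn0 hx.1
    rw [norm_mul, norm_neg, norm_cpow_eq_rpow_re_of_pos hx0]
    simp
  · simp

/-- partial sums of the L-series -/
noncomputable def pS {q : ℕ} (χ : DirichletCharacter ℂ q) (s : ℂ) (N : ℕ) : ℂ :=
  ∑ n ∈ Finset.Icc 1 N, χ (n : ZMod q) * (n : ℂ) ^ (-s)

lemma pS_succ {q : ℕ} (χ : DirichletCharacter ℂ q) (s : ℂ) (N : ℕ) :
    pS χ s (N + 1) = pS χ s N + χ ((N + 1 : ℕ) : ZMod q) * ((N + 1 : ℕ) : ℂ) ^ (-s) := by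
  unfold pS
  rw [Finset.sum_Icc_succ_top (by omega)]

lemma pS_diff {q : ℕ} [NeZero q] (χ : DirichletCharacter ℂ q) (hχ : χ ≠ 1) {s : ℂ}
    (hs : 0 < s.re) {N : ℕ} (hN : 1 ≤ N) (k : ℕ) :
    ‖pS χ s (N + k) - pS χ s N‖ ≤ 2 * q * (1 + ‖s‖ / s.re) * (N : ℝ) ^ (-s.re) := by
  set T : ℕ → ℂ := fun n => ∑ k ∈ Finset.range n, χ (k : ZMod q) with hT
  have hTb : ∀ n, ‖T n‖ ≤ q := char_sum_range_norm_le χ hχ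
  -- Abel summation
  have hid : ∀ k : ℕ, ‖pS χ s (N + k) - pS χ s N -
      (T (N + k + 1) - T (N + 1)) * ((N + k : ℕ) : ℂ) ^ (-s)‖ ≤
      2 * q * (‖s‖ / s.re) * ((N : ℝ) ^ (-s.re) - ((N + k : ℕ) : ℝ) ^ (-s.re)) := by
    intro k
    induction k with
    | zero => simp
    | succ k ih =>
      have e1 : pS χ s (N + (k + 1)) - pS χ s N -
        (T (N + (k + 1) + 1) - T (N + 1)) * ((N + (k + 1) : ℕ) : ℂ) ^ (-s) =
        (pS χ s (N + k) - pS χ s N - (T (N + k + 1) - T (N + 1)) * ((N + k : ℕ) : ℂ) ^ (-s)) -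
        (T (N + k + 1) - T (N + 1)) * (((N + k + 1 : ℕ) : ℂ) ^ (-s) - ((N + k : ℕ) : ℂ) ^ (-s)) := by
        have : T (N + (k + 1) + 1) = T (N + k + 1) + χ ((N + k + 1 : ℕ) : ZMod q) := by
          simp only [hT]
          rw [show N + (k + 1) + 1 = (N + k + 1) + 1 by ring, Finset.sum_range_succ]
        rw [show N + (k + 1) = N + k + 1 by ring] at this ⊢
        rw [this, pS_succ]
        ring
      rw [e1]
      have h2 := cpow_diff_norm_le hs (n := N + k) (by omega)
      have h3 : ‖T (N + k + 1) - T (N + 1)‖ ≤ 2 * q := by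
        refine (norm_sub_le _ _).trans ?_
        linarith [hTb (N + k + 1), hTb (N + 1)]
      refine (norm_sub_le _ _).trans ?_
      rw [norm_mul]
      have h4 := mul_le_mul h3 h2 (norm_nonneg _) (by positivity)
      rw [show N + (k + 1) = N + k + 1 by ring]
      calc _ ≤ _ := add_le_add ih h4
        _ = _ := by ring
  have h1 := hid k
  have hpos : 0 < N + k := by omega
  have h5 : ‖(T (N + k + 1) - T (N + 1)) * ((N + k : ℕ) : ℂ) ^ (-s)‖ ≤
      2 * q * ((N + k : ℕ) : ℝ) ^ (-s.re) := by
    rw [norm_mul, norm_natCast_cpow_of_pos hpos, neg_re]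
    refine mul_le_mul_of_nonneg_right ?_ (by positivity)
    refine (norm_sub_le _ _).trans ?_
    linarith [hTb (N + k + 1), hTb (N + 1)]
  have h6 : ((N + k : ℕ) : ℝ) ^ (-s.re) ≤ (N : ℝ) ^ (-s.re) := by
    apply Real.rpow_le_rpow_of_nonpos (by exact_mod_cast hN) (by push_cast; linarith [k.cast_nonneg (α := ℝ)]) (by linarith)
  have h7 : 0 ≤ ((N + k : ℕ) : ℝ) ^ (-s.re) := by positivity
  have h8 : 0 ≤ ‖s‖ / s.re := by positivity
  have h9 : (0 : ℝ) ≤ 2 * q := by positivity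
  calc ‖pS χ s (N + k) - pS χ s N‖ = ‖(pS χ s (N + k) - pS χ s N -
      (T (N + k + 1) - T (N + 1)) * ((N + k : ℕ) : ℂ) ^ (-s)) +
      (T (N + k + 1) - T (N + 1)) * ((N + k : ℕ) : ℂ) ^ (-s)‖ := by ring_nf
    _ ≤ _ := norm_add_le _ _
    _ ≤ _ := add_le_add h1 h5
    _ ≤ 2 * q * (‖s‖ / s.re) * (N : ℝ) ^ (-s.re) + 2 * q * (N : ℝ) ^ (-s.re) := by
      gcongr
      linarith
    _ = _ := by ring

lemma pS_tail_tendsto {s : ℂ} (hs : 0 < s.re) (C : ℝ) :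
    Tendsto (fun N : ℕ => C * (N : ℝ) ^ (-s.re)) atTop (𝓝 0) := by
  have := (tendsto_rpow_neg_atTop hs).comp tendsto_natCast_atTop_atTop
  simpa using this.const_mul C

lemma pS_exists_lim {q : ℕ} [NeZero q] (χ : DirichletCharacter ℂ q) (hχ : χ ≠ 1) {s : ℂ}
    (hs : 0 < s.re) : ∃ l, Tendsto (pS χ s) atTop (𝓝 l) := by
  apply cauchySeq_tendsto_of_complete
  refine cauchySeq_of_le_tendsto_0' (fun N => (2 * q * (1 + ‖s‖ / s.re)) * (N : ℝ) ^ (-s.re) +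
    (if N = 0 then ‖pS χ s 1 - pS χ s 0‖ + (2 * q * (1 + ‖s‖ / s.re)) * (1 : ℝ) ^ (-s.re) else 0)) ?_ ?_
  · intro n m hnm
    obtain ⟨k, rfl⟩ := Nat.exists_eq_add_of_le hnm
    rw [dist_comm, dist_eq_norm]
    have hnn : 0 ≤ 1 + ‖s‖ / s.re := by positivity
    rcases Nat.eq_zero_or_pos n with rfl | hn
    · simp only [if_true]
      rcases Nat.eq_zero_or_pos k with rfl | hk
      · simp only [add_zero, sub_self, norm_zero]
        positivity
      · obtain ⟨j, rfl⟩ := Nat.exists_eq_add_of_le hk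
        have := pS_diff χ hχ hs (N := 1) le_rfl j
        have h2 : pS χ s (0 + (1 + j)) - pS χ s 0 = (pS χ s (1 + j) - pS χ s 1) + (pS χ s 1 - pS χ s 0) := by
          rw [zero_add]; ring
        rw [h2]
        refine (norm_add_le _ _).trans ?_
        push_cast at this ⊢
        have h3 : 0 ≤ 2 * (q : ℝ) * (1 + ‖s‖ / s.re) * (0 : ℝ) ^ (-s.re) := by positivity
        linarith
    · rw [if_neg hn.ne', add_zero]
      exact pS_diff χ hχ hs hn k
  · have h1 := pS_tail_tendsto hs (2 * q * (1 + ‖s‖ / s.re))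
    have h2 : Tendsto (fun N : ℕ => if N = 0 then ‖pS χ s 1 - pS χ s 0‖ + (2 * q * (1 + ‖s‖ / s.re)) * (1 : ℝ) ^ (-s.re) else 0) atTop (𝓝 0) := by
      refine tendsto_const_nhds.congr' ?_
      filter_upwards [eventually_gt_atTop 0] with N hN
      rw [if_neg hN.ne']
    simpa using h1.add h2

/-- For `Re s > 0` the partial sums converge to the L-function. -/
lemma pS_tendsto {q : ℕ} [NeZero q] (χ : DirichletCharacter ℂ q) (hχ : χ ≠ 1) {s : ℂ}
    (hs : 0 < s.re) : Tendsto (pS χ s) atTop (𝓝 (χ.LFunction s)) := by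
  choose! l hl using fun (s : ℂ) (hs : 0 < s.re) => pS_exists_lim χ hχ hs
  have hU : IsOpen {s : ℂ | 0 < s.re} := isOpen_lt continuous_const continuous_re
  have hbound : ∀ s : ℂ, 0 < s.re → ∀ N : ℕ, 1 ≤ N →
      ‖l s - pS χ s N‖ ≤ 2 * q * (1 + ‖s‖ / s.re) * (N : ℝ) ^ (-s.re) := by
    intro s hs N hN
    have h1 : Tendsto (fun k => ‖pS χ s (N + k) - pS χ s N‖) atTop (𝓝 ‖l s - pS χ s N‖) := by
      have : Tendsto (fun k => pS χ s (N + k)) atTop (𝓝 (l s)) :=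
        (hl s hs).comp (tendsto_add_atTop_nat N |>.congr fun k => by ring)
      exact (this.sub_const _).norm
    exact le_of_tendsto' h1 fun k => pS_diff χ hχ hs hN k
  have hloc : TendstoLocallyUniformlyOn (fun N s => pS χ s N) l atTop {s : ℂ | 0 < s.re} := by
    rw [Metric.tendstoLocallyUniformlyOn_iff]
    intro ε hε x hx
    have hx' : 0 < x.re := hx
    refine ⟨{s : ℂ | x.re / 2 < s.re} ∩ {s : ℂ | ‖s‖ < ‖x‖ + 1}, ?_, ?_⟩
    · refine mem_nhdsWithin_of_mem_nhds (IsOpen.mem_nhds ?_ ?_)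
      · exact (isOpen_lt continuous_const continuous_re).inter (isOpen_lt continuous_norm continuous_const)
      · constructor
        · show x.re / 2 < x.re
          linarith
        · show ‖x‖ < ‖x‖ + 1
          linarith
    · have h1 := pS_tail_tendsto (s := (x.re / 2 : ℝ)) (by simpa using by linarith)
        (2 * q * (1 + (‖x‖ + 1) / (x.re / 2)))
      have h2 := (h1.eventually (gt_mem_nhds hε)).and (eventually_ge_atTop 1)
      filter_upwards [h2] with N hN y hy
      rw [dist_eq_norm]
      have hy1 : x.re / 2 < y.re := hy.1
      have hy2 : ‖y‖ < ‖x‖ + 1 := hy.2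
      refine lt_of_le_of_lt (hbound y (by linarith) N hN.2) (lt_of_le_of_lt ?_ hN.1)
      rw [ofReal_re]
      have hN1 : (1 : ℝ) ≤ N := by exact_mod_cast hN.2
      gcongr
  have hdl : DifferentiableOn ℂ l {s : ℂ | 0 < s.re} := by
    refine hloc.differentiableOn (Eventually.of_forall fun N => ?_) hU
    unfold pS
    refine DifferentiableOn.fun_sum fun n hn => ?_
    have hn0 : (n : ℂ) ≠ 0 := by
      simp only [Finset.mem_Icc] at hn
      exact_mod_cast (by omega : n ≠ 0)
    intro s hs
    refine DifferentiableAt.differentiableWithinAt ?_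
    exact (differentiableAt_const _).mul (DifferentiableAt.const_cpow (differentiableAt_id.neg) (Or.inl hn0))
  have heq : ∀ s : ℂ, 1 < s.re → l s = χ.LFunction s := by
    intro s hs
    refine tendsto_nhds_unique (hl s (by linarith)) ?_
    rw [LFunction_eq_LSeries χ hs]
    have h1 := (LSeriesSummable_of_one_lt_re χ hs).hasSum.tendsto_sum_nat
    have h2 := h1.comp (tendsto_add_atTop_nat 1)
    refine h2.congr fun N => ?_
    simp only [Function.comp, pS]
    rw [Finset.range_eq_Ico, Finset.sum_eq_sum_Ico_succ_bot (by omega)]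
    simp only [LSeries.term_zero, zero_add]
    refine Finset.sum_congr (by ext; simp) fun n hn => ?_
    have hn0 : n ≠ 0 := by simp at hn; omega
    rw [LSeries.term_of_ne_zero hn0, cpow_neg, div_eq_mul_inv]
  have hconv : Convex ℝ {s : ℂ | 0 < s.re} := convex_halfSpace_re_gt 0
  have hEq : Set.EqOn l χ.LFunction {s : ℂ | 0 < s.re} := by
    refine AnalyticOnNhd.eqOn_of_preconnected_of_eventuallyEq (z₀ := 2) (hdl.analyticOnNhd hU)
      ((differentiable_LFunction hχ).differentiableOn.analyticOnNhd hU) hconv.isPreconnected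
      (by simp) ?_
    have : {s : ℂ | 1 < s.re} ∈ 𝓝 (2 : ℂ) := (isOpen_lt continuous_const continuous_re).mem_nhds (by simp)
    filter_upwards [this] with s hs using heq s hs
  rw [← hEq hs]
  exact hl s hs

/-- truncation bound -/
lemma LFunction_sub_pS {q : ℕ} [NeZero q] (χ : DirichletCharacter ℂ q) (hχ : χ ≠ 1) {s : ℂ}
    (hs : 0 < s.re) {N : ℕ} (hN : 1 ≤ N) :
    ‖χ.LFunction s - pS χ s N‖ ≤ 2 * q * (1 + ‖s‖ / s.re) * (N : ℝ) ^ (-s.re) := by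
  have h1 : Tendsto (fun k => ‖pS χ s (N + k) - pS χ s N‖) atTop (𝓝 ‖χ.LFunction s - pS χ s N‖) := by
    have : Tendsto (fun k => pS χ s (N + k)) atTop (𝓝 (χ.LFunction s)) :=
      (pS_tendsto χ hχ hs).comp (tendsto_add_atTop_nat N |>.congr fun k => by ring)
    exact (this.sub_const _).norm
  exact le_of_tendsto' h1 fun k => pS_diff χ hχ hs hN k

end NSM


namespace NSM
open Filter Topology

/-- harmonic sums -/
noncomputable def Hr (N : ℕ) : ℝ := ∑ n ∈ Finset.Icc 1 N, 1 / (n : ℝ)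

lemma Hr_nonneg (N : ℕ) : 0 ≤ Hr N := Finset.sum_nonneg fun _ _ => by positivity

lemma Hr_mono {M N : ℕ} (h : M ≤ N) : Hr M ≤ Hr N :=
  Finset.sum_le_sum_of_subset_of_nonneg (Finset.Icc_subset_Icc_right h) fun _ _ _ => by positivity

lemma Hr_le {δ : ℝ} (hδ : 0 < δ) {N : ℕ} (hN : 1 ≤ N) : Hr N ≤ (1 + 1 / δ) * (N : ℝ) ^ δ := by
  have h1 : Hr N ≤ 1 + Real.log N := by
    have := harmonic_le_one_add_log N
    rw [harmonic_eq_sum_Icc] at this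
    unfold Hr
    push_cast at this
    simpa [one_div] using this
  have hN1 : (1 : ℝ) ≤ N := by exact_mod_cast hN
  have h2 : Real.log N ≤ (N : ℝ) ^ δ / δ := Real.log_le_rpow_div (by positivity) hδ
  have h3 : (1 : ℝ) ≤ (N : ℝ) ^ δ := Real.one_le_rpow hN1 hδ.le
  calc Hr N ≤ 1 + Real.log N := h1
    _ ≤ (N : ℝ) ^ δ + (N : ℝ) ^ δ / δ := add_le_add h3 h2
    _ = _ := by ring

lemma LFunction_sphere_bound {q : ℕ} [NeZero q] (χ : DirichletCharacter ℂ q) (hχ : χ ≠ 1) {s : ℂ}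
    (hs : s ∈ Metric.sphere (2 : ℂ) (4 / 3)) : ‖χ.LFunction s‖ ≤ 13 * q := by
  have hs' : ‖s - 2‖ = 4 / 3 := by simpa [dist_eq_norm] using hs
  have hre : 2 / 3 ≤ s.re := by
    have := abs_re_le_norm (s - 2)
    rw [hs'] at this
    have := (abs_le.1 this).1
    simp at this
    linarith
  have hn : ‖s‖ ≤ 10 / 3 := by
    have : s = (s - 2) + 2 := by ring
    rw [this]
    refine (norm_add_le _ _).trans ?_
    rw [hs']; norm_num
  have h := LFunction_sub_pS χ hχ (s := s) (by linarith) (N := 1) le_rfl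
  have h1 : pS χ s 1 = 1 := by simp [pS]
  rw [h1] at h
  have h2 : ‖s‖ / s.re ≤ 5 := by
    rw [div_le_iff₀ (by linarith)]
    linarith
  have h3 : ‖χ.LFunction s‖ ≤ ‖χ.LFunction s - 1‖ + 1 := by
    have := norm_add_le (χ.LFunction s - 1) 1
    simpa using this
  have hq : (1 : ℝ) ≤ q := by exact_mod_cast Nat.one_le_iff_ne_zero.2 (NeZero.ne q)
  have h4 : ‖χ.LFunction s - 1‖ ≤ 2 * q * (1 + 5) := by
    refine h.trans ?_
    simp only [Nat.cast_one, Real.one_rpow, mul_one]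
    gcongr
  linarith

lemma LFunction_near_one_bound {δ : ℝ} (hδ : 0 < δ) (hδ2 : δ ≤ 1 / 2) :
    ∃ C : ℝ, 1 ≤ C ∧ ∀ (q : ℕ) [NeZero q] (χ : DirichletCharacter ℂ q), χ ≠ 1 → ∀ s : ℂ,
      1 - δ ≤ s.re → ‖s‖ ≤ 4 → ‖χ.LFunction s‖ ≤ C * (q : ℝ) ^ (2 * δ) := by
  refine ⟨(1 + 1 / δ) + 18, by have : 0 < 1 / δ := by positivity
                               linarith, ?_⟩
  intro q _ χ hχ s hs hn
  have hq1 : 1 ≤ q := Nat.one_le_iff_ne_zero.2 (NeZero.ne q)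
  have hq : (1 : ℝ) ≤ q := by exact_mod_cast hq1
  have hre : 1 / 2 ≤ s.re := by linarith
  have h := LFunction_sub_pS χ hχ (s := s) (by linarith) (N := q) hq1
  have h2 : ‖s‖ / s.re ≤ 8 := by
    rw [div_le_iff₀ (by linarith)]
    linarith
  have hA : ‖χ.LFunction s - pS χ s q‖ ≤ 18 * (q : ℝ) ^ (2 * δ) := by
    calc _ ≤ _ := h
      _ ≤ 2 * q * (1 + 8) * (q : ℝ) ^ (2 * δ - 1) := by
        gcongr
        · linarith
      _ = 18 * (q * (q : ℝ) ^ (2 * δ - 1)) := by ring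
      _ = _ := by
        rw [Real.rpow_sub_one (by positivity)]
        field_simp
  have hB : ‖pS χ s q‖ ≤ (1 + 1 / δ) * (q : ℝ) ^ (2 * δ) := by
    calc ‖pS χ s q‖ ≤ ∑ n ∈ Finset.Icc 1 q, (q : ℝ) ^ δ * (1 / (n : ℝ)) := by
          refine norm_sum_le_of_le _ fun n hn => ?_
          simp only [Finset.mem_Icc] at hn
          have hn1 : (1 : ℝ) ≤ n := by exact_mod_cast hn.1
          have hnq : (n : ℝ) ≤ q := by exact_mod_cast hn.2
          rw [norm_mul, norm_natCast_cpow_of_pos (by omega), neg_re]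
          calc ‖χ (n : ZMod q)‖ * (n : ℝ) ^ (-s.re) ≤ 1 * (n : ℝ) ^ (δ - 1) := by
                gcongr
                · exact DirichletCharacter.norm_le_one χ _
                · linarith
            _ = (n : ℝ) ^ δ * (1 / (n : ℝ)) := by
                rw [Real.rpow_sub_one (by positivity)]
                ring
            _ ≤ _ := by gcongr
      _ = (q : ℝ) ^ δ * Hr q := by rw [← Finset.mul_sum]; rfl
      _ ≤ (q : ℝ) ^ δ * ((1 + 1 / δ) * (q : ℝ) ^ δ) := by
          gcongr
          exact Hr_le hδ hq1
      _ = _ := by rw [two_mul δ, Real.rpow_add (by positivity)]; ring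
  calc ‖χ.LFunction s‖ = ‖(χ.LFunction s - pS χ s q) + pS χ s q‖ := by ring_nf
    _ ≤ _ := norm_add_le _ _
    _ ≤ _ := add_le_add hA hB
    _ = _ := by ring

lemma LFunction_lipschitz {η : ℝ} (hη : 0 < η) :
    ∃ C : ℝ, 1 ≤ C ∧ ∀ (q : ℕ) [NeZero q] (χ : DirichletCharacter ℂ q), χ ≠ 1 → ∀ t : ℝ,
      0 ≤ t → t ≤ 1 → ‖χ.LFunction (1 + t) - χ.LFunction 1‖ ≤ C * (q : ℝ) ^ η * t ∧
        ‖χ.LFunction (1 + t)‖ ≤ C * (q : ℝ) ^ η := by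
  set δ := min (η / 2) (1 / 2) with hδ
  have hδ0 : 0 < δ := by positivity
  have hδ2 : δ ≤ 1 / 2 := min_le_right _ _
  have hδη : 2 * δ ≤ η := by have := min_le_left (η / 2) (1 / 2); rw [← hδ] at this; linarith
  obtain ⟨C, hC1, hC⟩ := LFunction_near_one_bound hδ0 hδ2
  have hC' : C ≤ C / δ := by
    rw [le_div_iff₀ hδ0]
    nlinarith
  refine ⟨C / δ, hC1.trans hC', ?_⟩
  intro q _ χ hχ t ht0 ht1
  have hq1 : 1 ≤ q := Nat.one_le_iff_ne_zero.2 (NeZero.ne q)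
  have hq : (1 : ℝ) ≤ q := by exact_mod_cast hq1
  have hle : (q : ℝ) ^ (2 * δ) ≤ (q : ℝ) ^ η := Real.rpow_le_rpow_of_exponent_le hq hδη
  have hb : ∀ s : ℂ, 1 - δ ≤ s.re → ‖s‖ ≤ 4 → ‖χ.LFunction s‖ ≤ C * (q : ℝ) ^ η :=
    fun s h1 h2 => (hC q χ hχ s h1 h2).trans (by gcongr)
  have hd : ∀ u ∈ Set.Icc (0:ℝ) 1, ‖deriv χ.LFunction (1 + u)‖ ≤ C / δ * (q : ℝ) ^ η := by
    intro u hu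
    have := Complex.norm_deriv_le_of_forall_mem_sphere_norm_le (f := χ.LFunction) (c := 1 + u)
      (C := C * (q : ℝ) ^ η) hδ0 ((differentiable_LFunction hχ).diffContOnCl) ?_
    · calc _ ≤ _ := this
        _ = _ := by ring
    · intro z hz
      have hz' : ‖z - (1 + u)‖ = δ := by simpa [dist_eq_norm] using hz
      apply hb
      · have := abs_re_le_norm (z - (1 + u))
        rw [hz'] at this
        have := (abs_le.1 this).1
        simp at this
        linarith [hu.1]
      · have e : z = (z - (1 + u)) + (1 + u) := by ring
        rw [e]
        refine (norm_add_le _ _).trans ?_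
        rw [hz']
        have : ‖(1 + u : ℂ)‖ ≤ 2 := by
          refine (norm_add_le _ _).trans ?_
          simp only [norm_one, norm_real, Real.norm_eq_abs, abs_of_nonneg hu.1]
          linarith [hu.2]
        linarith
  constructor
  · have := (convex_Icc (0:ℝ) 1).norm_image_sub_le_of_norm_hasDerivWithin_le
      (f := fun u : ℝ => χ.LFunction (1 + u)) (f' := fun u : ℝ => deriv χ.LFunction (1 + u))
      (C := C / δ * (q : ℝ) ^ η) (x := 0) (y := t) ?_ hd (by simp) ⟨ht0, ht1⟩
    · simpa [abs_of_nonneg ht0] using this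
    · intro u hu
      have h1 : HasDerivAt (fun z : ℂ => χ.LFunction (1 + z)) (deriv χ.LFunction (1 + u)) (u : ℂ) := by
        have h := ((differentiable_LFunction hχ) (1 + u)).hasDerivAt
        exact h.comp_const_add 1 (u : ℂ)
      exact h1.comp_ofReal.hasDerivWithinAt
  · refine (hb _ (by simp; linarith) ?_).trans (by gcongr)
    refine (norm_add_le _ _).trans ?_
    simp only [norm_one, norm_real, Real.norm_eq_abs, abs_of_nonneg ht0]
    linarith

lemma real_char_val {q : ℕ} (χ : DirichletCharacter ℂ q) (h2 : χ ^ 2 = 1) (a : ZMod q) :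
    χ a = 0 ∨ χ a = 1 ∨ χ a = -1 := by
  by_cases ha : IsUnit a
  · right
    have : χ a ^ 2 = 1 := by
      rw [← MulChar.pow_apply' χ two_ne_zero, h2, MulChar.one_apply ha]
    exact sq_eq_one_iff.1 this
  · left; exact MulChar.map_nonunit χ ha

lemma LFunction_real {q : ℕ} [NeZero q] (χ : DirichletCharacter ℂ q) (hχ : χ ≠ 1) (h2 : χ ^ 2 = 1)
    {t : ℝ} (ht : 0 < t) : (χ.LFunction t).im = 0 := by
  have h := pS_tendsto χ hχ (s := t) (by simpa using ht)
  have h' := (continuous_im.tendsto _).comp h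
  refine tendsto_nhds_unique h' (tendsto_const_nhds.congr fun N => ?_)
  simp only [Function.comp, pS, im_sum]
  symm
  refine Finset.sum_eq_zero fun n hn => ?_
  have e : ((n : ℂ) ^ (-(t : ℂ))) = (((n : ℝ) ^ (-t) : ℝ) : ℂ) := by
    rw [ofReal_cpow (by positivity)]; simp
  rw [e]
  rcases real_char_val χ h2 n with h | h | h <;> simp [h]

end NSM


namespace NSM
open Filter Topology
open scoped ComplexOrder

lemma est_real {a : ℕ → ℂ} {h : ℂ} (ha : HasSum a h) {g B β : ℝ} (hB : 1 ≤ B)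
    (hβ1 : β < 1)
    (h0 : 1 - g ≤ (a 0).re) (hm : ∀ m, - (g * (2 - β) ^ m) ≤ (a m).re)
    (hb : ∀ m, ‖a m‖ ≤ B * (27 / 32 : ℝ) ^ m) (hh : h.re ≤ g / (1 - β)) :
    ∃ M : ℕ, (M : ℝ) ≤ Real.log (13 * B) / Real.log (32 / 27) + 1 ∧
      1 / 2 ≤ g * (2 - β) ^ M / (1 - β) := by
  have hl : 0 < Real.log (32 / 27) := Real.log_pos (by norm_num)
  set M := ⌈Real.log (13 * B) / Real.log (32 / 27)⌉₊ with hM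
  have hlB : 0 < Real.log (13 * B) := Real.log_pos (by linarith)
  have hM1 : Real.log (13 * B) / Real.log (32 / 27) ≤ M := Nat.le_ceil _
  have hM0 : 1 ≤ M := by
    rw [hM, Nat.one_le_ceil_iff]
    positivity
  refine ⟨M, (Nat.ceil_lt_add_one (by positivity)).le, ?_⟩
  have hpow : 13 * B * (27 / 32 : ℝ) ^ M ≤ 1 := by
    rw [div_le_iff₀ hl] at hM1
    have h1 : 13 * B ≤ (32 / 27 : ℝ) ^ M := by
      rw [← Real.log_le_log_iff (by positivity) (by positivity), Real.log_pow]
      exact hM1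
    calc 13 * B * (27 / 32 : ℝ) ^ M ≤ (32 / 27 : ℝ) ^ M * (27 / 32 : ℝ) ^ M := by gcongr
      _ = 1 := by rw [← mul_pow]; norm_num
  have hre : HasSum (fun m => (a m).re) h.re := hasSum_re ha
  have hsplit := hre.summable.sum_add_tsum_nat_add M
  rw [hre.tsum_eq] at hsplit
  have htail : |∑' i, (a (i + M)).re| ≤ 1 / 2 := by
    have hg1 : HasSum (fun i : ℕ => B * (27 / 32 : ℝ) ^ M * (27 / 32 : ℝ) ^ i)
        (B * (27 / 32 : ℝ) ^ M * (1 - 27 / 32)⁻¹) :=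
      (hasSum_geometric_of_lt_one (by norm_num) (by norm_num)).mul_left _
    have := tsum_of_norm_bounded (f := fun i => (a (i + M)).re) hg1 (fun i => by
      rw [Real.norm_eq_abs]
      refine (abs_re_le_norm _).trans ((hb _).trans (le_of_eq ?_))
      rw [pow_add]; ring)
    rw [Real.norm_eq_abs] at this
    refine this.trans ?_
    norm_num at hpow ⊢
    linarith
  have hfin : 1 - g * (((2 - β) ^ M - 1) / (1 - β)) ≤ ∑ i ∈ Finset.range M, (a i).re := by
    have hgeom : ∑ i ∈ Finset.range M, (2 - β) ^ i = ((2 - β) ^ M - 1) / (1 - β) := by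
      rw [geom_sum_eq (by linarith)]
      congr 1; ring
    rw [← hgeom]
    obtain ⟨k, hk⟩ : ∃ k, M = k + 1 := ⟨M - 1, by omega⟩
    rw [hk, Finset.sum_range_succ', Finset.sum_range_succ']
    have : ∑ i ∈ Finset.range k, - (g * (2 - β) ^ (i + 1)) ≤ ∑ i ∈ Finset.range k, (a (i + 1)).re :=
      Finset.sum_le_sum fun i _ => hm _
    rw [Finset.sum_neg_distrib, ← Finset.mul_sum] at this
    rw [mul_add, pow_zero]
    linarith
  have h1 := (abs_le.1 htail).1
  have h2 : g * (2 - β) ^ M / (1 - β) = g / (1 - β) + g * (((2 - β) ^ M - 1) / (1 - β)) := by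
    have : (1 - β) ≠ 0 := by linarith
    field_simp
    ring
  rw [h2]
  linarith

lemma iteratedDeriv_inv_sub_one (m : ℕ) :
    iteratedDeriv m (fun s : ℂ => (s - 1)⁻¹) 2 = (-1) ^ m * m.factorial := by
  have h := iteratedDeriv_comp_sub_const m (fun s : ℂ => s⁻¹) 1
  have h2 := congrFun h 2
  rw [h2, iteratedDeriv_eq_iterate, iter_deriv_inv]
  norm_num

theorem estermann : ∃ c A : ℝ, 0 < c ∧ 0 < A ∧ ∀ (f : ℕ → ℂ) (G : ℂ → ℂ) (B β : ℝ), 0 ≤ f →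
    f 1 = 1 → LSeries.abscissaOfAbsConv f ≤ 1 → Differentiable ℂ G →
    (∀ s : ℂ, 1 < s.re → LSeries f s = riemannZeta s * G s) → 1 ≤ B →
    (∀ s ∈ Metric.sphere (2 : ℂ) (4 / 3), ‖G s‖ ≤ B) → 7 / 8 ≤ β → β < 1 →
    (riemannZeta β * G β).re ≤ 0 →
    c * (1 - β) * B ^ (-(A * (1 - β))) ≤ ‖G 1‖ := by
  obtain ⟨Kz, hKz⟩ : ∃ K : ℝ, ∀ s ∈ Metric.sphere (2 : ℂ) (4 / 3), ‖riemannZeta s‖ ≤ K := by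
    refine (isCompact_sphere (2 : ℂ) (4 / 3)).exists_bound_of_continuousOn fun s hs => ?_
    refine (differentiableAt_riemannZeta ?_).continuousAt.continuousWithinAt
    rintro rfl
    norm_num [dist_eq_norm] at hs
  set K := max Kz 1 + 3 with hK
  have hK1 : 4 ≤ K := by have := le_max_right Kz 1; linarith
  have hl : 0 < Real.log (32 / 27) := Real.log_pos (by norm_num)
  set L := Real.log (32 / 27) with hL
  refine ⟨(1 / 2) * Real.exp (-(Real.log (13 * K) / L + 1)), 1 / L, by positivity, by positivity, ?_⟩
  intro f G B β hf hf1 habs hG hFG hB hGB hβ hβ1 hre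
  -- entire function
  have hZ := differentiable_LFunctionTrivChar₁ (n := 1)
  set Z := LFunctionTrivChar₁ 1 with hZdef
  have hZ1 : Z 1 = 1 := by simp [hZdef, LFunctionTrivChar₁]
  have hZs : ∀ s : ℂ, s ≠ 1 → Z s = (s - 1) * riemannZeta s := by
    intro s hs
    simp [hZdef, LFunctionTrivChar₁, Function.update_of_ne hs, LFunctionTrivChar]
  set H : ℂ → ℂ := dslope (fun s => Z s * G s) 1 with hH
  have hHd : Differentiable ℂ H := by
    rw [← differentiableOn_univ]
    exact (Complex.differentiableOn_dslope Filter.univ_mem).2 (hZ.mul hG).differentiableOn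
  have hHs : ∀ s : ℂ, s ≠ 1 → H s = riemannZeta s * G s - G 1 * (s - 1)⁻¹ := by
    intro s hs
    have : s - 1 ≠ 0 := sub_ne_zero.2 hs
    rw [hH, dslope_of_ne _ hs, slope_def_field, hZs s hs, hZ1]
    field_simp
  have hG1 : ‖G 1‖ ≤ B := by
    refine Complex.norm_le_of_forall_mem_frontier_norm_le (U := Metric.ball (2:ℂ) (4 / 3))
      Metric.isBounded_ball hG.diffContOnCl ?_ (subset_closure ?_)
    · intro z hz
      rw [frontier_ball _ (by norm_num)] at hz
      exact hGB z hz
    · rw [Metric.mem_ball, dist_eq_norm]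
      norm_num
  have hHB : ∀ s ∈ Metric.sphere (2 : ℂ) (4 / 3), ‖H s‖ ≤ K * B := by
    intro s hs
    have hs' : ‖s - 2‖ = 4 / 3 := by simpa [dist_eq_norm] using hs
    have h13 : 1 / 3 ≤ ‖s - 1‖ := by
      have := norm_sub_norm_le (s - 2) (-1)
      rw [hs', norm_neg, norm_one] at this
      ring_nf at this ⊢
      linarith
    have hs1 : s ≠ 1 := by
      rintro rfl
      norm_num at h13
    rw [hHs s hs1]
    refine (norm_sub_le _ _).trans ?_
    rw [norm_mul, norm_mul, norm_inv]
    have h3 : ‖s - 1‖⁻¹ ≤ 3 := by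
      rw [inv_le_comm₀ (by linarith) (by norm_num)]
      linarith
    have hz : ‖riemannZeta s‖ ≤ max Kz 1 := (hKz s hs).trans (le_max_left _ _)
    calc _ ≤ max Kz 1 * B + B * 3 := by
          gcongr
          exact hGB s hs
      _ = K * B := by rw [hK]; ring
  -- Taylor
  have htay := hasSum_taylorSeries_of_entire hHd 2 (β : ℂ)
  have hder : ∀ m : ℕ, iteratedDeriv m H 2 =
      iteratedDeriv m (LSeries f) 2 - G 1 * ((-1) ^ m * m.factorial) := by
    intro m
    have hev : H =ᶠ[𝓝 2] (LSeries f - fun s => G 1 * (s - 1)⁻¹) := by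
      have : {s : ℂ | 1 < s.re} ∈ 𝓝 (2 : ℂ) :=
        (isOpen_lt continuous_const continuous_re).mem_nhds (by simp)
      filter_upwards [this] with s hs
      have hs1 : s ≠ 1 := by
        rintro rfl
        simp at hs
      rw [hHs s hs1, Pi.sub_apply, hFG s hs]
    rw [hev.iteratedDeriv_eq]
    have hA : AnalyticAt ℂ (LSeries f) 2 := by
      apply LSeries_analyticOnNhd f
      show LSeries.abscissaOfAbsConv f < ((2 : ℂ).re : EReal)
      refine habs.trans_lt ?_
      simp only [re_ofNat]
      exact_mod_cast (by norm_num : (1:ℝ) < 2)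
    have hI : AnalyticAt ℂ (fun s : ℂ => (s - 1)⁻¹) 2 := by
      refine (analyticAt_id.sub analyticAt_const).inv ?_
      norm_num
    have hcI : ContDiffAt ℂ m (fun s : ℂ => G 1 * (s - 1)⁻¹) 2 :=
      (analyticAt_const.mul hI).contDiffAt
    rw [iteratedDeriv_sub hA.contDiffAt hcI,
      iteratedDeriv_const_mul_field, iteratedDeriv_inv_sub_one]
  have hpos : ∀ m : ℕ, 0 ≤ (-1) ^ m * iteratedDeriv m (LSeries f) 2 := by
    intro m
    have := LSeries.iteratedDeriv_alternating hf (x := 2) (by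
      refine habs.trans_lt ?_
      exact_mod_cast (by norm_num : (1:ℝ) < 2)) m
    simpa using this
  have h0 : 1 ≤ (LSeries f 2).re := by
    have hsum : LSeriesSummable f 2 := LSeriesSummable_of_abscissaOfAbsConv_lt_re (by
      refine habs.trans_lt ?_
      simp only [re_ofNat]
      exact_mod_cast (by norm_num : (1:ℝ) < 2))
    have h1 : HasSum (fun n => (LSeries.term f 2 n).re) (LSeries f 2).re := hasSum_re hsum.hasSum
    have h2 := le_hasSum h1 1 (fun n _ => by
      have := LSeries.term_nonneg (hf n) 2
      have := (Complex.le_def.1 this).1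
      simpa using this)
    simpa [LSeries.term_of_ne_zero, hf1] using h2
  have hterm : ∀ m : ℕ, (m.factorial : ℂ)⁻¹ * (((β : ℂ) - 2) ^ m * iteratedDeriv m H 2) =
      (((2 - β) ^ m / m.factorial : ℝ) : ℂ) * ((-1) ^ m * iteratedDeriv m (LSeries f) 2) -
        G 1 * (((2 - β) ^ m : ℝ) : ℂ) := by
    intro m
    rw [hder m]
    have hfac : (m.factorial : ℂ) ≠ 0 := by exact_mod_cast m.factorial_ne_zero
    have e : ((β : ℂ) - 2) ^ m = (-1) ^ m * (2 - β) ^ m := by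
      rw [← mul_pow]; ring
    have e2 : ((-1 : ℂ) ^ m) * (-1) ^ m = 1 := by rw [← mul_pow]; norm_num
    rw [e]
    push_cast
    field_simp
    linear_combination (-(G 1) * (m.factorial : ℂ) * (2 - (β : ℂ)) ^ m) * e2
  have h2β : 0 ≤ 2 - β := by linarith
  have hlow : ∀ m : ℕ, ((((2 - β) ^ m / m.factorial : ℝ) : ℂ) *
      ((-1) ^ m * iteratedDeriv m (LSeries f) 2)).re - ‖G 1‖ * (2 - β) ^ m ≤
      ((m.factorial : ℂ)⁻¹ * (((β : ℂ) - 2) ^ m * iteratedDeriv m H 2)).re := by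
    intro m
    rw [hterm m, sub_re]
    have : (G 1 * (((2 - β) ^ m : ℝ) : ℂ)).re ≤ ‖G 1‖ * (2 - β) ^ m := by
      rw [re_mul_ofReal]
      gcongr
      exact re_le_norm _
    linarith
  obtain ⟨M, hM1, hM2⟩ := est_real (B := K * B) (β := β) (g := ‖G 1‖) htay (by nlinarith) hβ1
    (by
      have := hlow 0
      simp only [pow_zero, Nat.factorial_zero, Nat.cast_one, div_one, ofReal_one, one_mul, mul_one,
        iteratedDeriv_zero, smul_eq_mul, inv_one] at this ⊢
      simpa using (by linarith [this] : 1 - ‖G 1‖ ≤ _)) (by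
      intro m
      have := hlow m
      have h3 := (Complex.le_def.1 (hpos m)).1
      simp only [smul_eq_mul]
      rw [re_ofReal_mul] at this
      have h4 : 0 ≤ (2 - β) ^ m / m.factorial * ((-1) ^ m * iteratedDeriv m (LSeries f) 2).re :=
        mul_nonneg (by positivity) (by simpa using h3)
      linarith) (by
      intro m
      have hb := Complex.norm_iteratedDeriv_le_of_forall_mem_sphere_norm_le m (f := H) (c := 2)
        (R := 4 / 3) (C := K * B) (by norm_num) hHd.diffContOnCl hHB
      have hfac : (0 : ℝ) < m.factorial := by exact_mod_cast m.factorial_pos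
      have hn2 : ‖(β : ℂ) - 2‖ ≤ 9 / 8 := by
        rw [show (β : ℂ) - 2 = ((β - 2 : ℝ) : ℂ) by push_cast; ring, norm_real, Real.norm_eq_abs, abs_le]
        constructor <;> linarith
      simp only [smul_eq_mul, norm_mul, norm_inv, Complex.norm_natCast, norm_pow]
      calc (m.factorial : ℝ)⁻¹ * (‖(β : ℂ) - 2‖ ^ m * ‖iteratedDeriv m H 2‖)
          ≤ (m.factorial : ℝ)⁻¹ * ((9 / 8) ^ m * (m.factorial * (K * B) / (4 / 3) ^ m)) := by
            gcongr
        _ = K * B * ((9 / 8) ^ m / (4 / 3) ^ m) := by field_simp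
        _ = K * B * (27 / 32) ^ m := by rw [← div_pow]; norm_num) (by
      rw [hHs β (by exact_mod_cast hβ1.ne), sub_re]
      have : -(G 1 * ((β : ℂ) - 1)⁻¹).re ≤ ‖G 1‖ / (1 - β) := by
        have e : G 1 * ((β : ℂ) - 1)⁻¹ = - (G 1 * (((1 - β)⁻¹ : ℝ) : ℂ)) := by
          have h1 : (β : ℂ) - 1 ≠ 0 := sub_ne_zero.2 (by exact_mod_cast hβ1.ne)
          have h2 : (1 : ℂ) - β ≠ 0 := sub_ne_zero.2 (by exact_mod_cast hβ1.ne')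
          push_cast
          field_simp
          ring
        rw [e, neg_re, neg_neg, re_mul_ofReal, div_eq_mul_inv]
        have : 0 ≤ (1 - β)⁻¹ := inv_nonneg.2 (by linarith)
        gcongr
        exact re_le_norm _
      linarith)
  -- conclude
  have hδ : 0 < 1 - β := by linarith
  have hB0 : 0 < B := by linarith
  have hexp : (2 - β) ^ M ≤ Real.exp (Real.log (13 * K) / L + 1) * B ^ (1 / L * (1 - β)) := by
    have h1 : 2 - β ≤ Real.exp (1 - β) := by
      have := Real.add_one_le_exp (1 - β)
      linarith
    have hlk : 0 ≤ Real.log (13 * K) := Real.log_nonneg (by linarith)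
    calc (2 - β) ^ M ≤ Real.exp (1 - β) ^ M := by gcongr
      _ = Real.exp ((1 - β) * M) := by rw [← Real.exp_nat_mul]; ring_nf
      _ ≤ Real.exp ((1 - β) * (Real.log (13 * (K * B)) / L + 1)) := by gcongr
      _ = Real.exp ((1 - β) * (Real.log (13 * K) / L + 1) + Real.log B * (1 / L * (1 - β))) := by
        rw [← mul_assoc 13 K B, Real.log_mul (by positivity) (by positivity)]
        congr 1
        ring
      _ = Real.exp ((1 - β) * (Real.log (13 * K) / L + 1)) * B ^ (1 / L * (1 - β)) := by
        rw [Real.exp_add, Real.rpow_def_of_pos hB0]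
      _ ≤ _ := by
        gcongr
        have : 0 ≤ Real.log (13 * K) / L + 1 := by positivity
        nlinarith
  rw [Real.rpow_neg hB0.le, Real.exp_neg]
  set X := Real.exp (Real.log (13 * K) / L + 1) with hX
  set Y := B ^ (1 / L * (1 - β)) with hY
  have hX0 : 0 < X := Real.exp_pos _
  have hY0 : 0 < Y := Real.rpow_pos_of_pos hB0 _
  rw [le_div_iff₀ hδ] at hM2
  have h5 : 1 / 2 * (1 - β) ≤ ‖G 1‖ * (X * Y) := hM2.trans (by gcongr)
  calc 1 / 2 * X⁻¹ * (1 - β) * Y⁻¹ = (1 / 2 * (1 - β)) / (X * Y) := by field_simp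
    _ ≤ ‖G 1‖ := by rw [div_le_iff₀ (by positivity)]; exact h5

end NSM


namespace NSM
open Filter Topology
open scoped ComplexOrder ArithmeticFunction.vonMangoldt

/-- multiplication by log as derivation -/
noncomputable def DL (F : ArithmeticFunction ℂ) : ArithmeticFunction ℂ :=
  ⟨fun n => F n * (Real.log n : ℂ), by simp⟩

lemma DL_apply (F : ArithmeticFunction ℂ) (n : ℕ) : DL F n = F n * (Real.log n : ℂ) := rfl

lemma DL_mul (F G : ArithmeticFunction ℂ) : DL (F * G) = DL F * G + F * DL G := by
  ext n
  simp only [DL_apply, ArithmeticFunction.mul_apply, ArithmeticFunction.add_apply]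
  rw [Finset.sum_mul, ← Finset.sum_add_distrib]
  refine Finset.sum_congr rfl fun x hx => ?_
  obtain ⟨h1, h2⟩ := Nat.mem_divisorsAntidiagonal.1 hx
  have ha : (x.1 : ℝ) ≠ 0 := by
    intro h; apply h2; rw [← h1]; simp at h; simp [h]
  have hb : (x.2 : ℝ) ≠ 0 := by
    intro h; apply h2; rw [← h1]; simp at h; simp [h]
  rw [← h1, Nat.cast_mul, Real.log_mul ha hb]
  push_cast
  ring

noncomputable abbrev ch {q : ℕ} (χ : DirichletCharacter ℂ q) : ArithmeticFunction ℂ :=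
  toArithmeticFunction (fun n => χ (n : ZMod q))

noncomputable abbrev chL {q : ℕ} (χ : DirichletCharacter ℂ q) : ArithmeticFunction ℂ :=
  toArithmeticFunction (fun n => χ (n : ZMod q) * (Λ n : ℂ))

lemma ch_apply {q : ℕ} (χ : DirichletCharacter ℂ q) {n : ℕ} (hn : n ≠ 0) : ch χ n = χ (n : ZMod q) := by
  simp [ch, toArithmeticFunction, hn]

lemma one_mod_one (n : ZMod 1) : (1 : DirichletCharacter ℂ 1) n = 1 := by
  rw [Subsingleton.elim n 1, map_one]

lemma DL_ch {q : ℕ} (χ : DirichletCharacter ℂ q) : DL (ch χ) = chL χ * ch χ := by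
  have h := χ.convolution_twist_vonMangoldt
  ext n
  have h2 := congrFun h n
  unfold LSeries.convolution at h2
  rcases eq_or_ne n 0 with rfl | hn
  · simp
  have h3 : (chL χ * ch χ) n = χ (n : ZMod q) * Complex.log n := h2
  rw [h3]
  simp [DL, ch, toArithmeticFunction, hn]

lemma DL_zeta : DL ((ArithmeticFunction.zeta : ArithmeticFunction ℂ)) =
    chL (1 : DirichletCharacter ℂ 1) * (ArithmeticFunction.zeta : ArithmeticFunction ℂ) := by
  have := DL_ch (1 : DirichletCharacter ℂ 1)
  have h : ch (1 : DirichletCharacter ℂ 1) = (ArithmeticFunction.zeta : ArithmeticFunction ℂ) := by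
    ext n
    rcases eq_or_ne n 0 with rfl | hn
    · simp
    · rw [ch_apply _ hn, one_mod_one]; simp [hn, ArithmeticFunction.zeta_apply]
  rwa [h] at this

noncomputable def F4 {q : ℕ} (χ ψ : DirichletCharacter ℂ q) : ArithmeticFunction ℂ :=
  ((ArithmeticFunction.zeta : ArithmeticFunction ℂ) * ch χ) * (ch ψ * ch (χ * ψ))

lemma F4_one {q : ℕ} (χ ψ : DirichletCharacter ℂ q) : F4 χ ψ 1 = 1 := by
  unfold F4
  rw [ArithmeticFunction.mul_apply_one, ArithmeticFunction.mul_apply_one, ArithmeticFunction.mul_apply_one,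
    ch_apply _ one_ne_zero, ch_apply _ one_ne_zero, ch_apply _ one_ne_zero]
  simp

lemma DL_F4 {q : ℕ} (χ ψ : DirichletCharacter ℂ q) : DL (F4 χ ψ) =
    (chL (1 : DirichletCharacter ℂ 1) + chL χ + chL ψ + chL (χ * ψ)) * F4 χ ψ := by
  unfold F4
  rw [DL_mul, DL_mul, DL_mul, DL_zeta, DL_ch, DL_ch, DL_ch]
  ring

lemma F4_nonneg {q : ℕ} (χ ψ : DirichletCharacter ℂ q) (h1 : χ ^ 2 = 1) (h2 : ψ ^ 2 = 1) (n : ℕ) :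
    0 ≤ F4 χ ψ n := by
  induction n using Nat.strong_induction_on with
  | _ n ih =>
  rcases Nat.lt_or_ge n 2 with hn | hn
  · interval_cases n
    · simp
    · rw [F4_one]; exact zero_le_one
  have h := congrArg (fun f : ArithmeticFunction ℂ => f n) (DL_F4 χ ψ)
  simp only [ArithmeticFunction.mul_apply, ArithmeticFunction.add_apply] at h
  have hlog : 0 < Real.log n := Real.log_pos (by exact_mod_cast hn)
  have hsum : 0 ≤ (DL (F4 χ ψ)) n := by
    rw [h]
    refine Finset.sum_nonneg fun x hx => ?_
    obtain ⟨ha, hb⟩ := Nat.mem_divisorsAntidiagonal.1 hx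
    rcases eq_or_ne x.1 0 with h0 | h0
    · rw [h0] at ha; simp at ha; omega
    rcases eq_or_ne x.1 1 with h1' | h1'
    · simp [h1', toArithmeticFunction]
    have hx2 : x.2 ≠ 0 := by rintro h; rw [h] at ha; simp at ha; omega
    have hlt : x.2 < n := by
      rw [← ha]
      have : 2 ≤ x.1 := by omega
      nlinarith [Nat.pos_of_ne_zero hx2]
    refine mul_nonneg ?_ (ih _ hlt)
    have hL : (0:ℂ) ≤ (Λ x.1 : ℂ) := by exact_mod_cast ArithmeticFunction.vonMangoldt_nonneg
    have : (chL (1 : DirichletCharacter ℂ 1)) x.1 + chL χ x.1 + chL ψ x.1 + chL (χ * ψ) x.1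
      = (Λ x.1 : ℂ) * ((1 + χ x.1) * (1 + ψ x.1)) := by
      simp [chL, toArithmeticFunction, h0, one_mod_one]
      ring
    rw [this]
    refine mul_nonneg hL (mul_nonneg ?_ ?_)
    · rcases real_char_val χ h1 x.1 with h | h | h <;> rw [h] <;> norm_num
    · rcases real_char_val ψ h2 x.1 with h | h | h <;> rw [h] <;> norm_num
  have h3 : F4 χ ψ n = (DL (F4 χ ψ)) n * ((Real.log n)⁻¹ : ℝ) := by
    simp only [DL, ArithmeticFunction.coe_mk]
    rw [mul_assoc]
    norm_cast
    rw [mul_inv_cancel₀ hlog.ne']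
    simp
  rw [h3]
  refine mul_nonneg hsum ?_
  exact_mod_cast (inv_pos.2 hlog).le

lemma ch_summable {q : ℕ} (χ : DirichletCharacter ℂ q) {s : ℂ} (hs : 1 < s.re) :
    LSeriesSummable (ch χ) s := by
  refine LSeriesSummable_of_bounded_of_one_lt_re (m := 1) (fun n hn ↦ ?_) hs
  simpa only [ch, toArithmeticFunction, ArithmeticFunction.coe_mk, hn, ↓reduceIte]
    using norm_le_one χ _

lemma ch_LSeries {q : ℕ} [NeZero q] (χ : DirichletCharacter ℂ q) {s : ℂ} (hs : 1 < s.re) :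
    LSeries (ch χ) s = χ.LFunction s := by
  rw [LFunction_eq_LSeries χ hs]
  refine LSeries_congr (fun {n} hn => ?_) s
  simp [ch, toArithmeticFunction, hn]

lemma zeta_LSeries {s : ℂ} (hs : 1 < s.re) :
    LSeries (ArithmeticFunction.zeta : ArithmeticFunction ℂ) s = riemannZeta s := by
  rw [← ArithmeticFunction.LSeries_zeta_eq_riemannZeta hs]
  refine LSeries_congr (fun {n} hn => ?_) s
  simp 

lemma zeta_summable {s : ℂ} (hs : 1 < s.re) :
    LSeriesSummable (ArithmeticFunction.zeta : ArithmeticFunction ℂ) s := 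
  ArithmeticFunction.LSeriesSummable_zeta_iff.mpr hs

lemma estermann2 : ∃ c A : ℝ, 0<c ∧ 0<A ∧ ∀ (q : ℕ) [NeZero q] (χ : DirichletCharacter ℂ q) (β : ℝ),
    χ ≠ 1 → χ ^ 2 = 1 → 7/8 ≤ β → β < 1 → (riemannZeta β * χ.LFunction β).re ≤ 0 →
    c*(1-β)*(13 * q : ℝ)^(-(A*(1-β))) ≤ ‖χ.LFunction 1‖ := by
  obtain ⟨c, A, hc, hA, H⟩ := estermann
  refine ⟨c, A, hc, hA, fun q _ χ β hχ h2 hb hb1 hre => ?_⟩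
  have hq : (1:ℝ) ≤ q := by exact_mod_cast NeZero.one_le
  refine H (zetaMul χ) χ.LFunction (13 * q) β (fun n => zetaMul_nonneg h2 n)
    (isMultiplicative_zetaMul χ).map_one ?_ (differentiable_LFunction hχ) ?_ (by linarith) 
    (fun s hs => LFunction_sphere_bound χ hχ hs) hb hb1 hre
  · refine LSeries.abscissaOfAbsConv_le_of_forall_lt_LSeriesSummable fun y hy => ?_
    exact LSeriesSummable_zetaMul χ (by simpa using hy)
  · intro s hs
    unfold zetaMul
    rw [ArithmeticFunction.LSeries_mul' (zeta_summable hs) (ch_summable χ hs), ch_LSeries χ hs, zeta_LSeries hs]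

lemma estermann4 : ∃ c A : ℝ, 0<c ∧ 0<A ∧ ∀ (q : ℕ) [NeZero q] (χ ψ : DirichletCharacter ℂ q) (β : ℝ),
    χ ≠ 1 → χ ^ 2 = 1 → ψ ≠ 1 → ψ ^ 2 = 1 → χ * ψ ≠ 1 → 7/8 ≤ β → β < 1 → χ.LFunction β = 0 →
    c*(1-β)*((13 * q : ℝ)^3)^(-(A*(1-β))) ≤ ‖χ.LFunction 1‖ * ‖ψ.LFunction 1‖ * ‖(χ * ψ).LFunction 1‖ := by
  obtain ⟨c, A, hc, hA, H⟩ := estermann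
  refine ⟨c, A, hc, hA, fun q _ χ ψ β hχ h2 hψ h2' hm hb hb1 hre => ?_⟩
  have hq : (1:ℝ) ≤ q := by exact_mod_cast NeZero.one_le
  rw [← norm_mul, ← norm_mul]
  have hs1 : ∀ s : ℂ, 1 < s.re → LSeriesSummable (F4 χ ψ) s := fun s hs =>
    ArithmeticFunction.LSeriesSummable_mul (ArithmeticFunction.LSeriesSummable_mul (zeta_summable hs) (ch_summable χ hs))
      (ArithmeticFunction.LSeriesSummable_mul (ch_summable _ hs) (ch_summable _ hs))
  refine H (F4 χ ψ) (fun s => χ.LFunction s * ψ.LFunction s * (χ * ψ).LFunction s) ((13 * q)^3) β (fun n => F4_nonneg χ ψ h2 h2' n)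
    (F4_one χ ψ) ?_ (((differentiable_LFunction hχ).mul (differentiable_LFunction hψ)).mul (differentiable_LFunction hm)) ?_ (one_le_pow₀ (by linarith)) 
    ?_ hb hb1 (by simp [hre])
  · exact LSeries.abscissaOfAbsConv_le_of_forall_lt_LSeriesSummable fun y hy => hs1 _ (by simpa using hy)
  · intro s hs
    unfold F4
    rw [ArithmeticFunction.LSeries_mul' (ArithmeticFunction.LSeriesSummable_mul (zeta_summable hs) (ch_summable χ hs))
      (ArithmeticFunction.LSeriesSummable_mul (ch_summable _ hs) (ch_summable _ hs)), ArithmeticFunction.LSeries_mul' (zeta_summable hs) (ch_summable χ hs),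
      ArithmeticFunction.LSeries_mul' (ch_summable _ hs) (ch_summable _ hs), ch_LSeries χ hs, ch_LSeries ψ hs, ch_LSeries _ hs, zeta_LSeries hs]
    ring
  · intro s hs
    rw [norm_mul, norm_mul, pow_three']
    gcongr
    · exact LFunction_sphere_bound χ hχ hs
    · exact LFunction_sphere_bound ψ hψ hs
    · exact LFunction_sphere_bound _ hm hs
end NSM


namespace NSM
open Filter Topology

lemma divisor_bound {η : ℝ} (hη : 0 < η) : ∃ C : ℝ, 1 ≤ C ∧ ∀ n : ℕ, n ≠ 0 →
    (n.divisors.card : ℝ) ≤ C * (n : ℝ) ^ η := by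
  have hl2 : 0 < Real.log 2 := Real.log_pos (by norm_num)
  set D : ℝ := 1 + 1 / (η * Real.log 2) with hD
  have hD1 : 1 ≤ D := by rw [hD]; have : 0 < 1 / (η * Real.log 2) := by positivity
                         linarith
  obtain ⟨P, hP⟩ := exists_nat_ge ((2:ℝ) ^ (1 / η))
  refine ⟨D ^ P, one_le_pow₀ hD1, fun n hn => ?_⟩
  have key : ∀ p ∈ n.primeFactors, ((n.factorization p + 1 : ℕ) : ℝ) ≤
      (if p < P then D else 1) * ((p : ℝ) ^ n.factorization p) ^ η := by
    intro p hp
    have hp2 : (2:ℝ) ≤ p := by exact_mod_cast (Nat.prime_of_mem_primeFactors hp).two_le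
    set k := n.factorization p
    have e : ((p : ℝ) ^ k) ^ η = ((p:ℝ) ^ η) ^ k := by
      rw [← Real.rpow_natCast, ← Real.rpow_natCast, ← Real.rpow_mul (by linarith), ← Real.rpow_mul (by linarith), mul_comm]
    rw [e]
    split_ifs with h
    · have h1 : 1 + η * Real.log 2 ≤ (p:ℝ) ^ η := by
        calc 1 + η * Real.log 2 ≤ Real.exp (η * Real.log 2) := by
              have := Real.add_one_le_exp (η * Real.log 2); linarith
          _ = (2:ℝ) ^ η := by rw [Real.rpow_def_of_pos (by norm_num), mul_comm]
          _ ≤ _ := Real.rpow_le_rpow (by norm_num) hp2 hη.le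
      have h2 : 1 + k * (η * Real.log 2) ≤ ((p:ℝ) ^ η) ^ k := by
        refine (one_add_mul_le_pow (by have : 0 < η * Real.log 2 := by positivity
                                       linarith) k).trans ?_
        exact pow_le_pow_left₀ (by positivity) h1 k
      have h3 : ((k + 1 : ℕ) : ℝ) ≤ D * (1 + k * (η * Real.log 2)) := by
        rw [hD]
        push_cast
        have h4 : (1 + 1 / (η * Real.log 2)) * (1 + k * (η * Real.log 2)) =
          1 + k + k * (η * Real.log 2) + 1 / (η * Real.log 2) := by field_simp; ring
        rw [h4]
        have : 0 ≤ k * (η * Real.log 2) := by positivity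
        have : 0 ≤ 1 / (η * Real.log 2) := by positivity
        linarith
      refine h3.trans ?_
      gcongr
    · have h1 : (2:ℝ) ≤ (p:ℝ) ^ η := by
        calc (2:ℝ) = ((2:ℝ) ^ (1/η)) ^ η := by rw [← Real.rpow_mul (by norm_num)]; field_simp; simp
          _ ≤ _ := Real.rpow_le_rpow (by positivity) (hP.trans (by exact_mod_cast not_lt.1 h)) hη.le
      rw [one_mul]
      calc ((k + 1 : ℕ) : ℝ) ≤ 2 ^ k := by
            exact_mod_cast Nat.lt_two_pow_self
        _ ≤ _ := pow_le_pow_left₀ (by norm_num) h1 k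
  rw [Nat.card_divisors hn, Nat.cast_prod]
  refine (Finset.prod_le_prod (fun i _ => by positivity) key).trans ?_
  rw [Finset.prod_mul_distrib, Real.finsetProd_rpow _ _ (fun i _ => by positivity)]
  have e2 : ∏ i ∈ n.primeFactors, (i : ℝ) ^ n.factorization i = n := by
    have := Nat.prod_factorization_pow_eq_self hn
    conv_rhs => rw [← this]
    simp [Finsupp.prod]
  rw [e2]
  gcongr
  rw [← Finset.prod_filter, Finset.prod_const]
  refine pow_le_pow_right₀ hD1 ?_
  calc _ ≤ (Finset.range P).card := Finset.card_le_card (by intro x; simp)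
    _ = P := by simp

lemma two_pow_omega {η : ℝ} (hη : 0 < η) : ∃ C : ℝ, 1 ≤ C ∧ ∀ n : ℕ, n ≠ 0 →
    (2:ℝ) ^ n.primeFactors.card ≤ C * (n : ℝ) ^ η := by
  obtain ⟨C, hC, H⟩ := divisor_bound hη
  refine ⟨C, hC, fun n hn => le_trans ?_ (H n hn)⟩
  rw [Nat.card_divisors hn, ← Finset.prod_const, Nat.cast_prod]
  refine Finset.prod_le_prod (by simp) fun p hp => ?_
  have : 1 ≤ n.factorization p :=
    (Nat.prime_of_mem_primeFactors hp).factorization_pos_of_dvd hn (Nat.dvd_of_mem_primeFactors hp)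
  exact_mod_cast Nat.succ_le_succ this

lemma euler_factor_bounds {M N : ℕ} (χ : DirichletCharacter ℂ M) :
    ‖∏ p ∈ N.primeFactors, (1 - χ p * (p : ℂ) ^ (-(1:ℂ)))‖ ≤ 2 ^ N.primeFactors.card ∧
    1 ≤ 2 ^ N.primeFactors.card * ‖∏ p ∈ N.primeFactors, (1 - χ p * (p : ℂ) ^ (-(1:ℂ)))‖ := by
  rw [norm_prod]
  have h : ∀ p ∈ N.primeFactors, ‖χ p * (p : ℂ) ^ (-(1:ℂ))‖ ≤ 1 / 2 := by
    intro p hp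
    have hp2 : (2:ℝ) ≤ p := by exact_mod_cast (Nat.prime_of_mem_primeFactors hp).two_le
    rw [norm_mul, cpow_neg_one, norm_inv, norm_natCast]
    calc _ ≤ 1 * (2:ℝ)⁻¹ := by
          gcongr
          exact norm_le_one χ _
      _ = _ := by norm_num
  constructor
  · rw [← Finset.prod_const]
    refine Finset.prod_le_prod (by simp) fun p hp => ?_
    calc _ ≤ ‖(1:ℂ)‖ + ‖χ p * (p : ℂ) ^ (-(1:ℂ))‖ := norm_sub_le _ _
      _ ≤ 2 := by rw [norm_one]; linarith [h p hp]
  · rw [← Finset.prod_const, ← Finset.prod_mul_distrib]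
    rw [← Finset.prod_const_one (s := N.primeFactors)]
    refine Finset.prod_le_prod (by simp) fun p hp => ?_
    have := norm_sub_norm_le (1:ℂ) (χ p * (p : ℂ) ^ (-(1:ℂ)))
    rw [norm_one] at this
    linarith [h p hp]

lemma changeLevel_bounds {M N : ℕ} [NeZero M] [NeZero N] (hMN : M ∣ N) (χ : DirichletCharacter ℂ M)
    (hχ : χ ≠ 1) : ‖(changeLevel hMN χ).LFunction 1‖ ≤ 2 ^ N.primeFactors.card * ‖χ.LFunction 1‖ ∧
    ‖χ.LFunction 1‖ ≤ 2 ^ N.primeFactors.card * ‖(changeLevel hMN χ).LFunction 1‖ := by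
  rw [LFunction_changeLevel hMN χ (.inl hχ), norm_mul]
  obtain ⟨h1, h2⟩ := euler_factor_bounds (N := N) χ
  constructor
  · rw [mul_comm]; gcongr
  · nlinarith [norm_nonneg (χ.LFunction 1)]

lemma zeta_neg : ∃ δ : ℝ, 0 < δ ∧ δ ≤ 1/8 ∧ ∀ β : ℝ, 1 - δ ≤ β → β < 1 → (riemannZeta β).re < 0 := by
  have h1 : Tendsto (fun s : ℂ => ((s - 1) * riemannZeta s).re) (𝓝[≠] 1) (𝓝 1) := by
    have := (continuous_re.tendsto (1:ℂ)).comp riemannZeta_residue_one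
    rwa [one_re] at this
  have h2 := h1.eventually (lt_mem_nhds (zero_lt_one))
  rw [eventually_nhdsWithin_iff, Metric.eventually_nhds_iff] at h2
  obtain ⟨d, hd, H⟩ := h2
  refine ⟨min (d/2) (1/8), by positivity, min_le_right _ _, fun β hb hb1 => ?_⟩
  have := min_le_left (d/2) (1/8)
  have h3 := @H (β : ℂ) (by
    rw [dist_eq, ← ofReal_one, ← ofReal_sub, norm_real, Real.norm_eq_abs, abs_lt]; constructor <;> linarith) (by
    intro h; simp at h; norm_cast at h; linarith)
  rw [← ofReal_one, ← ofReal_sub, re_ofReal_mul] at h3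
  nlinarith

lemma L_nonneg {q : ℕ} [NeZero q] (χ : DirichletCharacter ℂ q) (hχ : χ ≠ 1) (h2 : χ ^ 2 = 1) {β : ℝ} (hβ : 0 < β)
    (hz : ∀ x : ℝ, β ≤ x → x < 1 → χ.LFunction x ≠ 0) : 0 ≤ (χ.LFunction β).re := by
  by_contra hneg
  push Not at hneg
  have ht : Tendsto (fun x : ℝ => (χ.LFunction x).re) atTop (𝓝 1) := by
    have h1 := LSeries.tendsto_atTop (f := fun n : ℕ => χ n) (by
      exact lt_of_le_of_lt (LSeries.abscissaOfAbsConv_le_one_of_isBigO_one (by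
        refine Asymptotics.IsBigO.of_bound 1 (Filter.Eventually.of_forall fun n => ?_)
        simpa using norm_le_one χ _)) (by exact EReal.coe_lt_top 1))
    have h2 := (continuous_re.tendsto _).comp h1
    simp only [Nat.cast_one, map_one, one_re] at h2
    refine h2.congr' ?_
    filter_upwards [eventually_gt_atTop 1] with x hx
    simp only [Function.comp]
    rw [LFunction_eq_LSeries χ (by simpa using hx)]
  obtain ⟨x, hx1, hx2⟩ := ((ht.eventually (lt_mem_nhds zero_lt_one)).and (eventually_ge_atTop (max β 1))).exists
  have hc : ContinuousOn (fun x : ℝ => (χ.LFunction x).re) (Set.Icc β x) := by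
    have := (differentiable_LFunction hχ).continuous
    exact (continuous_re.comp (this.comp continuous_ofReal)).continuousOn
  have := intermediate_value_Icc ((le_max_left _ _).trans hx2) hc
  obtain ⟨y, hy, hy0⟩ := this ⟨hneg.le, hx1.le⟩
  have hy00 : χ.LFunction y = 0 := Complex.ext hy0 (LFunction_real χ hχ h2 (lt_of_lt_of_le hβ hy.1))
  rcases lt_or_ge y 1 with h | h
  · exact hz y hy.1 h hy00
  · exact LFunction_ne_zero_of_one_le_re χ (.inl hχ) (by simpa using h) hy00

theorem siegel_real {ε : ℝ} (hε : 0 < ε) : ∃ c : ℝ, 0 < c ∧ ∀ (q : ℕ) [NeZero q] (χ : DirichletCharacter ℂ q),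
    χ ≠ 1 → χ ^ 2 = 1 → c * (q:ℝ) ^ (-ε) ≤ ‖χ.LFunction 1‖ := by
  obtain ⟨δ0, hδ0, hδ8, hζ⟩ := zeta_neg
  obtain ⟨c2, A2, hc2, hA2, E2⟩ := estermann2
  obtain ⟨c4, A4, hc4, hA4, E4⟩ := estermann4
  set δ := min δ0 (min (ε / A2) (ε / (6 * A4))) with hδ
  have hδpos : 0 < δ := by positivity
  have hd0 : δ ≤ δ0 := min_le_left _ _
  have hd2 : A2 * δ ≤ ε := by
    have : δ ≤ ε / A2 := (min_le_right _ _).trans (min_le_left _ _)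
    rw [le_div_iff₀ hA2] at this; linarith
  have hd4 : 3 * (A4 * δ) ≤ ε / 2 := by
    have : δ ≤ ε / (6 * A4) := (min_le_right _ _).trans (min_le_right _ _)
    rw [le_div_iff₀ (by positivity)] at this; linarith
  by_cases hcase : ∃ (q1 : ℕ) (_ : NeZero q1) (χ1 : DirichletCharacter ℂ q1) (β : ℝ), χ1 ≠ 1 ∧ χ1 ^ 2 = 1 ∧
      1 - δ ≤ β ∧ β < 1 ∧ χ1.LFunction β = 0
  · obtain ⟨q1, _, χ1, β, hχ1, h21, hβ, hβ1, hzero⟩ := hcase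
    have hη : 0 < ε / 8 := by positivity
    obtain ⟨C1, hC1, W⟩ := two_pow_omega hη
    obtain ⟨C2, hC2, U⟩ := LFunction_lipschitz hη
    have hL1 : 0 < ‖χ1.LFunction 1‖ := norm_pos_iff.2 (LFunction_apply_one_ne_zero hχ1)
    have hb : 0 < 1 - β := by linarith
    set k := min (‖χ1.LFunction 1‖ / C1 ^ 2) (c4 * (1 - β) * (13:ℝ) ^ (-(ε/2)) / (C2 ^ 2 * C1)) with hk
    have hkpos : 0 < k := by positivity
    refine ⟨k * (q1 : ℝ) ^ (-ε), by have : (0:ℝ) < q1 := by exact_mod_cast NeZero.pos q1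
                                    positivity, fun q _ χ hχ h2 => ?_⟩
    set N := q1 * q with hN
    have : NeZero N := ⟨mul_ne_zero (NeZero.ne q1) (NeZero.ne q)⟩
    have hN0 : (0:ℝ) < N := by exact_mod_cast NeZero.pos N
    have hN1 : (1:ℝ) ≤ N := by exact_mod_cast NeZero.one_le
    have d1 : q1 ∣ N := dvd_mul_right _ _
    have d2 : q ∣ N := dvd_mul_left _ _
    set ψ1 := changeLevel d1 χ1 with hψ1
    set ψ2 := changeLevel d2 χ with hψ2
    have n1 : ψ1 ≠ 1 := fun h => hχ1 ((changeLevel_eq_one_iff d1).1 h)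
    have n2 : ψ2 ≠ 1 := fun h => hχ ((changeLevel_eq_one_iff d2).1 h)
    have s1 : ψ1 ^ 2 = 1 := by rw [hψ1, ← map_pow, h21, map_one]
    have s2 : ψ2 ^ 2 = 1 := by rw [hψ2, ← map_pow, h2, map_one]
    have b2 := (changeLevel_bounds d2 χ hχ).1
    have b1 := (changeLevel_bounds d1 χ1 hχ1).2
    have w := W N (NeZero.ne N)
    have e0 : k * (q1 : ℝ) ^ (-ε) * (q:ℝ) ^ (-ε) = k * (N:ℝ) ^ (-ε) := by
      rw [hN, Nat.cast_mul, Real.mul_rpow (by positivity) (by positivity)]; ring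
    rw [e0]
    set T := (N:ℝ) ^ (ε / 8) with hT
    have hT1 : 1 ≤ T := Real.one_le_rpow hN1 hη.le
    have eN : (N:ℝ) ^ (-ε) = (T ^ 8)⁻¹ := by
      rw [hT, ← Real.rpow_natCast, ← Real.rpow_mul hN0.le, ← Real.rpow_neg hN0.le]; congr 1; push_cast; ring
    have eN2 : (N:ℝ) ^ (-(ε/2)) = (T ^ 4)⁻¹ := by
      rw [hT, ← Real.rpow_natCast, ← Real.rpow_mul hN0.le, ← Real.rpow_neg hN0.le]; congr 1; push_cast; ring
    rw [eN, ← div_eq_mul_inv, div_le_iff₀ (by positivity)]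
    have b2' : ‖ψ2.LFunction 1‖ ≤ C1 * T * ‖χ.LFunction 1‖ := b2.trans (by gcongr)
    by_cases hm : ψ1 * ψ2 = 1
    · have hE : ψ1 = ψ2 := by
        have : ψ1 * ψ2 * ψ2 = ψ1 := by rw [mul_assoc, ← sq, s2, mul_one]
        rw [← this, hm, one_mul]
      have b1' : ‖χ1.LFunction 1‖ ≤ C1 * T * ‖ψ2.LFunction 1‖ := by
        rw [← hE]; exact b1.trans (by gcongr)
      have : ‖χ1.LFunction 1‖ ≤ C1 * T * (C1 * T * ‖χ.LFunction 1‖) := b1'.trans (by gcongr)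
      calc k ≤ ‖χ1.LFunction 1‖ / C1 ^ 2 := min_le_left _ _
        _ ≤ ‖χ.LFunction 1‖ * T ^ 2 := by rw [div_le_iff₀ (by positivity)]; linarith
        _ ≤ _ := by gcongr; norm_num
    · have e4 := E4 N ψ1 ψ2 β n1 s1 n2 s2 hm (by linarith) hβ1 (by
        rw [hψ1, LFunction_changeLevel d1 χ1 (.inl hχ1), hzero, zero_mul])
      have u1 := (U N ψ1 n1 0 le_rfl zero_le_one).2
      have u2 := (U N (ψ1 * ψ2) hm 0 le_rfl zero_le_one).2
      simp only [ofReal_zero, add_zero] at u1 u2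
      have l1 : (13:ℝ) ^ (-(ε/2)) * (T^4)⁻¹ ≤ ((13 * N : ℝ)^3)^(-(A4*(1-β))) := by
        rw [← eN2, ← Real.mul_rpow (by norm_num) hN0.le, ← Real.rpow_natCast, ← Real.rpow_mul (by positivity)]
        refine Real.rpow_le_rpow_of_exponent_le (by linarith) ?_
        have : A4 * (1 - β) ≤ A4 * δ := by gcongr; linarith
        push_cast
        linarith
      have l2 : c4 * (1 - β) * ((13:ℝ) ^ (-(ε/2)) * (T^4)⁻¹) ≤ (C2 * T) * (C1 * T * ‖χ.LFunction 1‖) * (C2 * T) := by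
        refine le_trans (by gcongr) (e4.trans ?_)
        gcongr
      calc k ≤ c4 * (1 - β) * (13:ℝ) ^ (-(ε/2)) / (C2 ^ 2 * C1) := min_le_right _ _
        _ = (c4 * (1 - β) * ((13:ℝ) ^ (-(ε/2)) * (T^4)⁻¹)) * T ^ 4 / (C2 ^ 2 * C1) := by field_simp
        _ ≤ ((C2 * T) * (C1 * T * ‖χ.LFunction 1‖) * (C2 * T)) * T ^ 4 / (C2 ^ 2 * C1) := by gcongr
        _ = ‖χ.LFunction 1‖ * T ^ 7 := by field_simp
        _ ≤ _ := by gcongr; norm_num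
  · push Not at hcase
    refine ⟨c2 * δ * 13 ^ (-ε), by positivity, fun q _ χ hχ h2 => ?_⟩
    have hq1 : (1:ℝ) ≤ q := by exact_mod_cast NeZero.one_le
    have hp := L_nonneg χ hχ h2 (β := 1 - δ) (by linarith) (fun x hx hx1 => hcase q inferInstance χ x hχ h2 hx hx1)
    have him := LFunction_real χ hχ h2 (t := 1 - δ) (by linarith)
    have := E2 q χ (1 - δ) hχ h2 (by linarith) (by linarith) (by
      rw [mul_re, him, mul_zero, sub_zero]
      exact mul_nonpos_of_nonpos_of_nonneg (hζ _ (by linarith) (by linarith)).le hp)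
    refine le_trans ?_ this
    rw [mul_assoc, ← Real.mul_rpow (by norm_num) (by positivity), sub_sub_cancel]
    gcongr
    · linarith
end NSM


namespace NSM
open Filter Topology

lemma zeta_near : ∃ δ : ℝ, 0 < δ ∧ δ ≤ 1 ∧ ∀ x : ℝ, 0 < x → x ≤ δ → ‖riemannZeta (1 + x)‖ ≤ 2 / x := by
  have h1 : Tendsto (fun s : ℂ => ‖(s - 1) * riemannZeta s‖) (𝓝[≠] 1) (𝓝 1) := by
    have := riemannZeta_residue_one.norm
    rwa [norm_one] at this
  have h2 := h1.eventually (gt_mem_nhds (one_lt_two))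
  rw [eventually_nhdsWithin_iff, Metric.eventually_nhds_iff] at h2
  obtain ⟨d, hd, H⟩ := h2
  refine ⟨min (d/2) 1, by positivity, min_le_right _ _, fun x hx hx1 => ?_⟩
  have := min_le_left (d/2) 1
  have h3 := @H (1 + x : ℂ) (by
    rw [dist_eq, add_sub_cancel_left, norm_real, Real.norm_eq_abs, abs_lt]; constructor <;> linarith) (by
    simp [hx.ne'])
  rw [add_sub_cancel_left, norm_mul, norm_real, Real.norm_eq_abs, abs_of_pos hx] at h3
  rw [le_div_iff₀ hx]
  linarith

lemma triv_near : ∃ δ : ℝ, 0 < δ ∧ δ ≤ 1 ∧ ∀ x : ℝ, 0 < x → x ≤ δ → ∀ (q : ℕ) [NeZero q],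
    ‖LFunctionTrivChar q (1 + x)‖ ≤ 2 / x := by
  obtain ⟨δ, h1, h2, H⟩ := zeta_near
  refine ⟨δ, h1, h2, fun x hx hx1 q _ => ?_⟩
  rw [LFunctionTrivChar_eq_mul_riemannZeta (by simp [hx.ne']), norm_mul, norm_prod]
  refine le_trans ?_ (H x hx hx1)
  refine mul_le_of_le_one_left (norm_nonneg _) ?_
  refine Finset.prod_le_one (fun _ _ => norm_nonneg _) fun p hp => ?_
  have hp2 : (1:ℝ) ≤ p := by exact_mod_cast (Nat.prime_of_mem_primeFactors hp).one_le
  have e : (1:ℂ) - (p:ℂ) ^ (-(1 + x : ℂ)) = ((1 - (p:ℝ) ^ (-(1 + x)) : ℝ) : ℂ) := by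
    push_cast [ofReal_cpow (by linarith : (0:ℝ) ≤ p)]
    simp
  rw [e, norm_real, Real.norm_eq_abs, abs_le]
  have h3 : (p:ℝ) ^ (-(1 + x)) ≤ 1 := Real.rpow_le_one_of_one_le_of_nonpos hp2 (by linarith)
  have h4 : 0 ≤ (p:ℝ) ^ (-(1 + x)) := by positivity
  constructor <;> linarith

theorem complex_lower {ε : ℝ} (hε : 0 < ε) : ∃ c : ℝ, 0 < c ∧ ∀ (q : ℕ) [NeZero q] (χ : DirichletCharacter ℂ q),
    χ ≠ 1 → χ ^ 2 ≠ 1 → c * (q:ℝ) ^ (-ε) ≤ ‖χ.LFunction 1‖ := by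
  obtain ⟨δ, h1, h2, H⟩ := triv_near
  obtain ⟨C, hC, U⟩ := LFunction_lipschitz (show 0 < ε / 4 by positivity)
  refine ⟨δ / (256 * C ^ 4), by positivity, fun q _ χ hχ hχ2 => ?_⟩
  have hq1 : (1:ℝ) ≤ q := by exact_mod_cast NeZero.one_le
  set T := C * (q:ℝ) ^ (ε/4) with hT
  have hT1 : 1 ≤ T := by
    have := Real.one_le_rpow hq1 (show 0 ≤ ε/4 by positivity)
    nlinarith
  set x := δ / (256 * T ^ 5) with hx
  have hx0 : 0 < x := by positivity
  have hT5 : 1 ≤ T ^ 5 := one_le_pow₀ hT1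
  have hxδ : x ≤ δ := by rw [hx]; exact div_le_self h1.le (by linarith)
  have e : δ / (256 * C ^ 4) * (q:ℝ) ^ (-ε) = T * x := by
    have : (q:ℝ) ^ (-ε) = (((q:ℝ) ^ (ε/4)) ^ 4)⁻¹ := by
      rw [← Real.rpow_natCast, ← Real.rpow_mul (by positivity), ← Real.rpow_neg (by positivity)]
      congr 1; push_cast; ring
    rw [this, hx]
    have : T ^ 4 = C ^ 4 * ((q:ℝ) ^ (ε/4)) ^ 4 := by rw [hT]; ring
    have h3 : C ^ 4 * ((q:ℝ) ^ (ε/4)) ^ 4 ≠ 0 := by positivity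
    rw [show T * (δ / (256 * T ^ 5)) = δ / (256 * T ^ 4) by field_simp, this]
    field_simp
  rw [e]
  by_contra hlt
  push Not at hlt
  obtain ⟨u1, -⟩ := U q χ hχ x hx0.le (by linarith)
  obtain ⟨-, u2⟩ := U q (χ ^ 2) hχ2 x hx0.le (by linarith)
  have p := norm_LFunction_product_ge_one χ hx0 0
  simp only [ofReal_zero, mul_zero, add_zero] at p
  rw [norm_mul, norm_mul, norm_pow, norm_pow] at p
  have v : ‖χ.LFunction (1 + x)‖ ≤ 2 * (T * x) := by
    have := norm_sub_norm_le (χ.LFunction (1 + x)) (χ.LFunction 1)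
    linarith
  have : 1 ≤ (2 / x) ^ 3 * (2 * (T * x)) ^ 4 * T := by
    refine p.le.trans ?_
    gcongr
    exact H x hx0 hxδ q
  have e2 : (2 / x) ^ 3 * (2 * (T * x)) ^ 4 * T = 128 * T ^ 5 * x := by
    field_simp; ring
  have e3 : 128 * T ^ 5 * x = δ / 2 := by rw [hx]; field_simp; ring
  rw [e2, e3] at this
  linarith

theorem L_lower {ε : ℝ} (hε : 0 < ε) : ∃ C : ℝ, 1 ≤ C ∧ ∀ (q : ℕ) [NeZero q] (χ : DirichletCharacter ℂ q),
    χ ≠ 1 → 0 < ‖χ.LFunction 1‖ ∧ ‖χ.LFunction 1‖⁻¹ ≤ C * (q:ℝ) ^ ε := by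
  obtain ⟨c1, h1, H1⟩ := siegel_real hε
  obtain ⟨c2, h2, H2⟩ := complex_lower hε
  refine ⟨max 1 (max c1⁻¹ c2⁻¹), le_max_left _ _, fun q _ χ hχ => ?_⟩
  have hL1 : 0 < ‖χ.LFunction 1‖ := norm_pos_iff.2 (LFunction_apply_one_ne_zero hχ)
  refine ⟨hL1, ?_⟩
  have hq1 : (0:ℝ) < q := by exact_mod_cast NeZero.pos q
  have key : ∀ c : ℝ, 0 < c → c * (q:ℝ) ^ (-ε) ≤ ‖χ.LFunction 1‖ → ‖χ.LFunction 1‖⁻¹ ≤ c⁻¹ * (q:ℝ) ^ ε := by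
    intro c hc h
    have := inv_anti₀ (by positivity) h
    rwa [mul_inv, ← Real.rpow_neg hq1.le, neg_neg] at this
  by_cases h : χ ^ 2 = 1
  · refine (key c1 h1 (H1 q χ hχ h)).trans ?_
    gcongr
    exact (le_max_left _ _).trans (le_max_right _ _)
  · refine (key c2 h2 (H2 q χ hχ h)).trans ?_
    gcongr
    exact (le_max_right _ _).trans (le_max_right _ _)

/-- the package of bounds -/
structure Kb (q : ℕ) [NeZero q] (K : ℝ) : Prop where
  one_le : 1 ≤ K
  up : ∀ χ : DirichletCharacter ℂ q, χ ≠ 1 → ‖χ.LFunction 1‖ ≤ K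
  low : ∀ χ : DirichletCharacter ℂ q, χ ≠ 1 → ‖χ.LFunction 1‖⁻¹ ≤ K
  harm : Hr (2 * q ^ 5) ≤ K
  div : ∀ n : ℕ, n ≠ 0 → n ≤ q ^ 5 → (n.divisors.card : ℝ) ≤ K

theorem exists_Kb {η : ℝ} (hη : 0 < η) : ∃ C : ℝ, 1 ≤ C ∧ ∀ (q : ℕ) [NeZero q], Kb q (C * (q:ℝ) ^ η) := by
  obtain ⟨C1, h1, H1⟩ := L_lower hη
  obtain ⟨C2, h2, H2⟩ := LFunction_lipschitz hη
  obtain ⟨C3, h3, H3⟩ := divisor_bound (show 0 < η / 5 by positivity)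
  set C4 := (1 + 1 / (η/5)) * 2 ^ (η/5) with hC4
  have h4 : 0 ≤ C4 := by positivity
  refine ⟨C1 + C2 + C3 + C4, by linarith, fun q _ => ?_⟩
  have hq1 : (1:ℝ) ≤ q := by exact_mod_cast NeZero.one_le
  have hT1 : 1 ≤ (q:ℝ) ^ η := Real.one_le_rpow hq1 hη.le
  have e5 : ((q:ℝ) ^ 5) ^ (η / 5) = (q:ℝ) ^ η := by
    rw [← Real.rpow_natCast, ← Real.rpow_mul (by positivity)]
    congr 1; push_cast; field_simp
  refine ⟨by nlinarith, fun χ hχ => ?_, fun χ hχ => ?_, ?_, fun n hn hnq => ?_⟩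
  · have := (H2 q χ hχ 0 le_rfl zero_le_one).2
    simp only [ofReal_zero, add_zero] at this
    refine this.trans ?_
    gcongr; linarith
  · refine (H1 q χ hχ).2.trans ?_
    gcongr; linarith
  · have := Hr_le (show 0 < η / 5 by positivity) (N := 2 * q ^ 5) (Nat.mul_pos two_pos (pow_pos (NeZero.pos q) 5))
    refine this.trans ?_
    push_cast
    rw [Real.mul_rpow (by norm_num) (by positivity), e5, ← mul_assoc, ← hC4]
    gcongr; linarith
  · refine (H3 n hn).trans ?_
    calc C3 * (n:ℝ) ^ (η/5) ≤ C3 * ((q:ℝ) ^ 5) ^ (η / 5) := by gcongr; exact_mod_cast hnq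
      _ ≤ _ := by rw [e5]; gcongr; linarith
end NSM


namespace NSM
open Filter Topology

open Classical in
noncomputable def Ev (q : ℕ) [NeZero q] : Finset (DirichletCharacter ℂ q) :=
  Finset.univ.filter (fun χ => χ.Even)

noncomputable def W {q : ℕ} [NeZero q] (a b : ZMod q) : ℂ :=
  ∑ χ ∈ Ev q, χ a * (starRingEnd ℂ) (χ b)

lemma W_unit {q : ℕ} [NeZero q] (a b : ZMod q) (hb : IsUnit b) :
    W a b = ((if b = a then (q.totient : ℂ) else 0) + (if b = -a then (q.totient : ℂ) else 0)) / 2 := by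
  classical
  rw [← sum_char_inv_mul_char_eq ℂ hb a, ← sum_char_inv_mul_char_eq ℂ hb (-a), ← Finset.sum_add_distrib,
    Finset.sum_div, W, Ev, Finset.sum_filter]
  refine Finset.sum_congr rfl fun χ _ => ?_
  have hs : (starRingEnd ℂ) (χ b) = χ b⁻¹ := by
    have h1 : χ b * χ b⁻¹ = 1 := by
      rw [← map_mul, ZMod.mul_inv_of_unit b hb, map_one]
    have h2 : ‖χ b‖ = 1 := by
      obtain ⟨u, rfl⟩ := hb
      exact χ.unit_norm_eq_one u
    have h3 : χ b * (starRingEnd ℂ) (χ b) = 1 := by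
      rw [mul_conj, normSq_eq_norm_sq, h2]; simp
    have h4 : χ b ≠ 0 := by intro h; rw [h, norm_zero] at h2; exact zero_ne_one h2
    exact mul_left_cancel₀ h4 (h3.trans h1.symm)
  rcases χ.even_or_odd with h | h
  · rw [if_pos h, h.eval_neg, hs]; ring
  · have h' : ¬ χ.Even := fun h' => not_even_and_odd χ ⟨h', h⟩
    rw [if_neg h', h.eval_neg]; ring

lemma W_nonunit {q : ℕ} [NeZero q] (a b : ZMod q) (hb : ¬ IsUnit b) : W a b = 0 := by
  unfold W
  refine Finset.sum_eq_zero fun χ _ => ?_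
  rw [χ.map_nonunit hb]; simp

lemma W_norm_le {q : ℕ} [NeZero q] (a b : ZMod q) : ‖W a b‖ ≤ q := by
  by_cases hb : IsUnit b
  · rw [W_unit a b hb, norm_div]
    have ht : ((q.totient : ℕ) : ℝ) ≤ q := by exact_mod_cast Nat.totient_le q
    have h1 : ∀ P : Prop, ∀ [Decidable P], ‖(if P then (q.totient : ℂ) else 0)‖ ≤ q := by
      intro P _
      split_ifs
      · simpa using ht
      · simp
    have := norm_add_le (if b = a then (q.totient : ℂ) else 0) (if b = -a then (q.totient : ℂ) else 0)
    have h2 := h1 (b = a)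
    have h3 := h1 (b = -a)
    rw [div_le_iff₀ (by simp)]
    simp only [Complex.norm_ofNat]
    linarith
  · rw [W_nonunit a b hb]; simp

lemma W_eq_zero {q : ℕ} [NeZero q] (m n : ℕ) (h1 : (n : ZMod q) ≠ m) (h2 : ¬ q ∣ m + n) : W (m : ZMod q) n = 0 := by
  by_cases hb : IsUnit (n : ZMod q)
  · rw [W_unit _ _ hb, if_neg h1, if_neg]
    · simp
    · intro h
      apply h2
      rw [← ZMod.natCast_eq_zero_iff]
      push_cast; rw [h]; ring
  · exact W_nonunit _ _ hb

lemma W_diag {q : ℕ} [NeZero q] (hq : 3 ≤ q) (n : ℕ) : W (n : ZMod q) n = if n.Coprime q then (q.totient : ℂ) / 2 else 0 := by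
  by_cases hb : IsUnit (n : ZMod q)
  · rw [W_unit _ _ hb, if_pos rfl, if_neg, if_pos ((ZMod.isUnit_iff_coprime _ _).1 hb), add_zero]
    intro h
    have h2 : (n : ZMod q) * 2 = 0 := by
      have : (n : ZMod q) + n = 0 := by nth_rw 1 [h]; ring
      rw [mul_two]; exact this
    have h3 : (2 : ZMod q) = 0 := (hb.mul_right_eq_zero).1 h2
    have h4 : ((2:ℕ) : ZMod q) = 0 := by exact_mod_cast h3
    rw [ZMod.natCast_eq_zero_iff] at h4
    have := Nat.le_of_dvd two_pos h4
    omega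
  · rw [W_nonunit _ _ hb, if_neg (fun h => hb ((ZMod.isUnit_iff_coprime _ _).2 h))]

lemma sum_inv_mult_le {q X : ℕ} (hq : 0 < q) (S : Finset ℕ) (f : ℕ → ℕ) (hf : Set.InjOn f S)
    (h1 : ∀ n ∈ S, q ∣ f n) (h2 : ∀ n ∈ S, 1 ≤ f n) (h3 : ∀ n ∈ S, f n ≤ X) :
    ∑ n ∈ S, 1 / (f n : ℝ) ≤ Hr X / q := by
  have e : ∀ n ∈ S, 1 / (f n : ℝ) = (1 / ((f n / q : ℕ) : ℝ)) / q := by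
    intro n hn
    obtain ⟨k, hk⟩ := h1 n hn
    have : f n / q = k := by rw [hk]; exact Nat.mul_div_cancel_left k hq
    rw [this, hk]; push_cast; rw [div_div, mul_comm]
  rw [Finset.sum_congr rfl e, ← Finset.sum_div]
  gcongr
  have hinj : Set.InjOn (fun n => f n / q) S := by
    intro a ha b hb hab
    apply hf ha hb
    obtain ⟨k, hk⟩ := h1 a ha
    obtain ⟨l, hl⟩ := h1 b hb
    simp only [hk, hl, Nat.mul_div_cancel_left _ hq] at hab
    rw [hk, hl, hab]
  rw [← Finset.sum_image (f := fun k : ℕ => 1 / (k : ℝ)) hinj, Hr]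
  refine Finset.sum_le_sum_of_subset_of_nonneg ?_ (fun i _ _ => by positivity)
  intro k hk
  obtain ⟨n, hn, rfl⟩ := Finset.mem_image.1 hk
  rw [Finset.mem_Icc]
  refine ⟨?_, (Nat.div_le_self _ _).trans (h3 n hn)⟩
  exact Nat.div_pos (Nat.le_of_dvd (h2 n hn) (h1 n hn)) hq

lemma offdiag {q : ℕ} [NeZero q] (Q : ℕ) :
    ∑ m ∈ Finset.Icc 1 Q, ∑ n ∈ Finset.Icc 1 Q,
      (if m ≠ n ∧ ((n : ZMod q) = m ∨ q ∣ m + n) then 1 / ((m:ℝ) * n) else 0) ≤ 4 * Hr (2 * Q) ^ 2 / q := by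
  have hq := NeZero.pos q
  set g : ℕ → ℕ → ℝ := fun m n => if q ∣ m + n then 1 / (m:ℝ) * (1 / ((m + n : ℕ) : ℝ)) else 0 with hg
  set h : ℕ → ℕ → ℝ := fun m n => if m < n ∧ q ∣ n - m then 1 / (m:ℝ) * (1 / ((n - m : ℕ) : ℝ)) else 0 with hh
  have g0 : ∀ m n, 0 ≤ g m n := fun m n => by simp only [hg]; split_ifs <;> positivity
  have h0 : ∀ m n, 0 ≤ h m n := fun m n => by simp only [hh]; split_ifs <;> positivity
  have key : ∀ m ∈ Finset.Icc 1 Q, ∀ n ∈ Finset.Icc 1 Q,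
      (if m ≠ n ∧ ((n : ZMod q) = m ∨ q ∣ m + n) then 1 / ((m:ℝ) * n) else 0) ≤ g m n + g n m + (h m n + h n m) := by
    intro m hm n hn
    have hm1 := (Finset.mem_Icc.1 hm).1
    have hn1 := (Finset.mem_Icc.1 hn).1
    have hm0 : (0:ℝ) < m := by exact_mod_cast hm1
    have hn0 : (0:ℝ) < n := by exact_mod_cast hn1
    split_ifs with hc
    · obtain ⟨hne, hc⟩ := hc
      have aux : ∀ m n : ℕ, 1 ≤ m → m < n → (n : ZMod q) = m → 1 / ((m:ℝ) * n) ≤ h m n := by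
        intro m n hm1 hlt he
        have hm0 : (0:ℝ) < m := by exact_mod_cast hm1
        have hd : q ∣ n - m := by
          rw [← ZMod.natCast_eq_zero_iff, Nat.cast_sub hlt.le, he, sub_self]
        simp only [hh]
        rw [if_pos ⟨hlt, hd⟩, ← one_div_mul_one_div]
        have : (0:ℝ) < (n - m : ℕ) := by exact_mod_cast Nat.sub_pos_of_lt hlt
        gcongr
        exact Nat.sub_le _ _
      rcases hc with hc | hc
      · rcases lt_or_gt_of_ne hne with hlt | hlt
        · have := aux m n hm1 hlt hc
          linarith [g0 m n, g0 n m, h0 n m]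
        · have := aux n m hn1 hlt hc.symm
          rw [mul_comm]
          linarith [g0 m n, g0 n m, h0 m n]
      · have e : g m n + g n m = 1 / ((m:ℝ) * n) := by
          simp only [hg]
          rw [if_pos hc, if_pos (by rwa [add_comm]), add_comm n m]
          push_cast
          field_simp
          ring
        linarith [h0 m n, h0 n m]
    · linarith [g0 m n, g0 n m, h0 m n, h0 n m]
  have H0 := Hr_nonneg (2 * Q)
  have HQ : Hr Q ≤ Hr (2 * Q) := Hr_mono (by omega)
  have sg : ∑ m ∈ Finset.Icc 1 Q, ∑ n ∈ Finset.Icc 1 Q, g m n ≤ Hr (2 * Q) ^ 2 / q := by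
    calc _ ≤ ∑ m ∈ Finset.Icc 1 Q, 1 / (m:ℝ) * (Hr (2 * Q) / q) := by
          refine Finset.sum_le_sum fun m hm => ?_
          simp only [hg]
          rw [← Finset.sum_filter, ← Finset.mul_sum]
          gcongr
          refine sum_inv_mult_le hq _ (fun n => m + n) (fun a _ b _ hab => by simpa using hab) ?_ ?_ ?_
          · intro n hn; exact (Finset.mem_filter.1 hn).2
          · intro n hn; have := Finset.mem_Icc.1 hm; omega
          · intro n hn; have := Finset.mem_Icc.1 hm; have := Finset.mem_Icc.1 (Finset.mem_filter.1 hn).1; omega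
      _ = Hr Q * (Hr (2 * Q) / q) := by rw [← Finset.sum_mul]; rfl
      _ ≤ Hr (2 * Q) * (Hr (2 * Q) / q) := by gcongr
      _ = _ := by ring
  have sh : ∑ m ∈ Finset.Icc 1 Q, ∑ n ∈ Finset.Icc 1 Q, h m n ≤ Hr (2 * Q) ^ 2 / q := by
    calc _ ≤ ∑ m ∈ Finset.Icc 1 Q, 1 / (m:ℝ) * (Hr (2 * Q) / q) := by
          refine Finset.sum_le_sum fun m hm => ?_
          simp only [hh]
          rw [← Finset.sum_filter, ← Finset.mul_sum]
          gcongr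
          refine sum_inv_mult_le hq _ (fun n => n - m) (fun a ha b hb hab => ?_) ?_ ?_ ?_
          · have h1 := (Finset.mem_filter.1 ha).2.1
            have h2 := (Finset.mem_filter.1 hb).2.1
            simp only at hab
            omega
          · intro n hn; exact (Finset.mem_filter.1 hn).2.2
          · intro n hn; have := (Finset.mem_filter.1 hn).2.1; omega
          · intro n hn; have := Finset.mem_Icc.1 (Finset.mem_filter.1 hn).1; omega
      _ = Hr Q * (Hr (2 * Q) / q) := by rw [← Finset.sum_mul]; rfl
      _ ≤ Hr (2 * Q) * (Hr (2 * Q) / q) := by gcongr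
      _ = _ := by ring
  refine (Finset.sum_le_sum fun m hm => Finset.sum_le_sum fun n hn => key m hm n hn).trans ?_
  simp only [Finset.sum_add_distrib]
  have sg' : ∑ m ∈ Finset.Icc 1 Q, ∑ n ∈ Finset.Icc 1 Q, g n m ≤ Hr (2 * Q) ^ 2 / q := by
    rw [Finset.sum_comm]; exact sg
  have sh' : ∑ m ∈ Finset.Icc 1 Q, ∑ n ∈ Finset.Icc 1 Q, h n m ≤ Hr (2 * Q) ^ 2 / q := by
    rw [Finset.sum_comm]; exact sh
  have : 4 * Hr (2 * Q) ^ 2 / q = Hr (2 * Q) ^ 2 / q + Hr (2 * Q) ^ 2 / q + (Hr (2 * Q) ^ 2 / q + Hr (2 * Q) ^ 2 / q) := by ring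
  rw [this]
  gcongr

noncomputable def DD {q : ℕ} (Q : ℕ) (a : ℕ → ℝ) (χ : DirichletCharacter ℂ q) : ℂ :=
  ∑ n ∈ Finset.Icc 1 Q, (a n : ℂ) * χ (n : ZMod q)

theorem mean_value {q : ℕ} [NeZero q] (Q : ℕ) (a b : ℕ → ℝ) {A B : ℝ} (hA : 0 ≤ A) (hB : 0 ≤ B)
    (ha : ∀ n ∈ Finset.Icc 1 Q, |a n| ≤ A / n) (hb : ∀ n ∈ Finset.Icc 1 Q, |b n| ≤ B / n) :
    ‖∑ χ ∈ Ev q, DD Q a χ * (starRingEnd ℂ) (DD Q b χ) -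
      ∑ n ∈ Finset.Icc 1 Q, ((a n * b n : ℝ) : ℂ) * W (n : ZMod q) n‖ ≤ 4 * (A * B) * Hr (2 * Q) ^ 2 := by
  have e1 : ∑ χ ∈ Ev q, DD Q a χ * (starRingEnd ℂ) (DD Q b χ) =
      ∑ m ∈ Finset.Icc 1 Q, ∑ n ∈ Finset.Icc 1 Q, ((a m * b n : ℝ) : ℂ) * W (m : ZMod q) n := by
    have : ∀ χ : DirichletCharacter ℂ q, DD Q a χ * (starRingEnd ℂ) (DD Q b χ) =
        ∑ m ∈ Finset.Icc 1 Q, ∑ n ∈ Finset.Icc 1 Q, ((a m * b n : ℝ) : ℂ) * (χ m * (starRingEnd ℂ) (χ n)) := by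
      intro χ
      simp only [DD, map_sum, map_mul, conj_ofReal]
      rw [Finset.sum_mul_sum]
      refine Finset.sum_congr rfl fun m _ => ?_
      refine Finset.sum_congr rfl fun n _ => ?_
      push_cast; ring
    rw [Finset.sum_congr rfl fun χ _ => this χ, Finset.sum_comm]
    refine Finset.sum_congr rfl fun m _ => ?_
    rw [Finset.sum_comm]
    refine Finset.sum_congr rfl fun n _ => ?_
    rw [W, Finset.mul_sum]
  have e2 : ∑ n ∈ Finset.Icc 1 Q, ((a n * b n : ℝ) : ℂ) * W (n : ZMod q) n =
      ∑ m ∈ Finset.Icc 1 Q, ∑ n ∈ Finset.Icc 1 Q, (if m = n then ((a m * b n : ℝ) : ℂ) * W (m : ZMod q) n else 0) := by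
    refine Finset.sum_congr rfl fun m hm => ?_
    rw [Finset.sum_ite_eq, if_pos hm]
  rw [e1, e2, ← Finset.sum_sub_distrib]
  simp only [← Finset.sum_sub_distrib]
  have hq : (0:ℝ) < q := by exact_mod_cast NeZero.pos q
  calc _ ≤ ∑ m ∈ Finset.Icc 1 Q, ∑ n ∈ Finset.Icc 1 Q, A * B * q * 
        (if m ≠ n ∧ ((n : ZMod q) = m ∨ q ∣ m + n) then 1 / ((m:ℝ) * n) else 0) := by
        refine (norm_sum_le _ _).trans (Finset.sum_le_sum fun m hm => ?_)
        refine (norm_sum_le _ _).trans (Finset.sum_le_sum fun n hn => ?_)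
        by_cases hmn : m = n
        · simp [hmn]
        rw [if_neg hmn, sub_zero]
        by_cases hc : (n : ZMod q) = m ∨ q ∣ m + n
        · rw [if_pos ⟨hmn, hc⟩, norm_mul, norm_real, Real.norm_eq_abs, abs_mul]
          calc _ ≤ (A / m * (B / n)) * q := by
                gcongr
                · exact ha m hm
                · exact hb n hn
                · exact W_norm_le _ _
            _ = _ := by rw [← one_div_mul_one_div]; ring
        · rw [if_neg (fun h => hc h.2)]
          push Not at hc
          rw [W_eq_zero m n hc.1 hc.2]; simp
    _ = A * B * q * ∑ m ∈ Finset.Icc 1 Q, ∑ n ∈ Finset.Icc 1 Q,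
        (if m ≠ n ∧ ((n : ZMod q) = m ∨ q ∣ m + n) then 1 / ((m:ℝ) * n) else 0) := by
        simp only [Finset.mul_sum]
    _ ≤ A * B * q * (4 * Hr (2 * Q) ^ 2 / q) := by gcongr; exact offdiag Q
    _ = _ := by field_simp
end NSM


namespace NSM
open Filter Topology
open scoped ArithmeticFunction.Moebius

noncomputable def tw {q : ℕ} (a : ArithmeticFunction ℝ) (χ : DirichletCharacter ℂ q) : ArithmeticFunction ℂ :=
  ⟨fun n => (a n : ℂ) * χ (n : ZMod q), by simp⟩

lemma tw_apply {q : ℕ} (a : ArithmeticFunction ℝ) (χ : DirichletCharacter ℂ q) (n : ℕ) :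
    tw a χ n = (a n : ℂ) * χ (n : ZMod q) := rfl

lemma tw_mul {q : ℕ} (a b : ArithmeticFunction ℝ) (χ : DirichletCharacter ℂ q) : tw (a * b) χ = tw a χ * tw b χ := by
  ext n
  simp only [tw_apply, ArithmeticFunction.mul_apply]
  push_cast
  rw [Finset.sum_mul]
  refine Finset.sum_congr rfl fun x hx => ?_
  obtain ⟨h1, h2⟩ := Nat.mem_divisorsAntidiagonal.1 hx
  rw [← h1, Nat.cast_mul, map_mul]; ring

lemma DD_mul {q : ℕ} (Q : ℕ) (a b : ArithmeticFunction ℝ) (χ : DirichletCharacter ℂ q)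
    (h : ∀ x y : ℕ, a x ≠ 0 → b y ≠ 0 → x * y ≤ Q) : DD Q (a * b : ArithmeticFunction ℝ) χ = DD Q a χ * DD Q b χ := by
  have e : ∀ c : ArithmeticFunction ℝ, DD Q c χ = ∑ n ∈ Finset.Ioc 0 Q, tw c χ n := fun c => rfl
  rw [e, e, e, tw_mul, ArithmeticFunction.sum_Ioc_mul_eq_sum_prod_filter, Finset.sum_mul_sum, ← Finset.sum_product', Finset.sum_filter]
  refine Finset.sum_congr rfl fun x _ => ?_
  split_ifs with hx
  · rfl
  · symm
    by_contra hne
    apply hx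
    refine h _ _ (fun h0 => hne ?_) (fun h0 => hne ?_) <;> simp [tw_apply, h0]

noncomputable def mA (q : ℕ) : ArithmeticFunction ℝ :=
  ⟨fun n => if n ≤ q then (μ n : ℝ) / n else 0, by simp⟩
noncomputable def pA (q : ℕ) : ArithmeticFunction ℝ :=
  ⟨fun n => if n ≤ q ^ 3 then 1 / (n : ℝ) else 0, by simp⟩
noncomputable def eA (q : ℕ) : ArithmeticFunction ℝ := mA q * pA q - 1

lemma mA_apply (q n : ℕ) : mA q n = if n ≤ q then (μ n : ℝ) / n else 0 := rfl
lemma pA_apply (q n : ℕ) : pA q n = if n ≤ q ^ 3 then 1 / (n:ℝ) else 0 := rfl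

lemma mA_le (q n : ℕ) : |mA q n| ≤ 1 / n := by
  rw [mA_apply]
  split_ifs
  · rw [abs_div, Nat.abs_cast]
    gcongr
    exact_mod_cast ArithmeticFunction.abs_moebius_le_one
  · simp

lemma pA_le (q n : ℕ) : |pA q n| ≤ 1 / n := by
  rw [pA_apply]
  split_ifs
  · rw [abs_div, Nat.abs_cast, abs_one]
  · simp

lemma mul_bound (a b : ArithmeticFunction ℝ) {A B : ℝ} (hA : 0 ≤ A) (hB : 0 ≤ B) (n : ℕ) (ha : ∀ x, x ∣ n → |a x| ≤ A / x)
    (hb : ∀ x, x ∣ n → |b x| ≤ B / x) : |(a * b) n| ≤ n.divisors.card * (A * B) / n := by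
  rw [ArithmeticFunction.mul_apply]
  refine (Finset.abs_sum_le_sum_abs _ _).trans ?_
  calc _ ≤ ∑ x ∈ n.divisorsAntidiagonal, (A * B) / n := by
        refine Finset.sum_le_sum fun x hx => ?_
        obtain ⟨h1, h2⟩ := Nat.mem_divisorsAntidiagonal.1 hx
        rw [abs_mul]
        calc _ ≤ (A / x.1) * (B / x.2) := by
              gcongr
              · exact ha _ (Dvd.intro _ h1)
              · exact hb _ (Dvd.intro_left _ h1)
          _ = _ := by rw [← h1]; push_cast; rw [div_mul_div_comm]
    _ = _ := by
        rw [Finset.sum_const, nsmul_eq_mul, ← Nat.map_div_right_divisors, Finset.card_map]; ring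

lemma mp_small {q n : ℕ} [NeZero q] (hn0 : n ≠ 0) (hn : n ≤ q) : (mA q * pA q) n = if n = 1 then 1 else 0 := by
  have h1 : (mA q * pA q) n = ((∑ x ∈ n.divisorsAntidiagonal, (μ x.1 : ℤ) : ℤ) : ℝ) / n := by
    rw [ArithmeticFunction.mul_apply]
    push_cast
    rw [Finset.sum_div]
    refine Finset.sum_congr rfl fun x hx => ?_
    obtain ⟨h1, h2⟩ := Nat.mem_divisorsAntidiagonal.1 hx
    have l1 : x.1 ≤ n := Nat.le_of_dvd (by omega) (Dvd.intro _ h1)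
    have l2 : x.2 ≤ n := Nat.le_of_dvd (by omega) (Dvd.intro_left _ h1)
    have : q ≤ q ^ 3 := Nat.le_self_pow (by norm_num) q
    rw [mA_apply, pA_apply, if_pos (by omega), if_pos (by omega), ← h1]
    push_cast; rw [div_mul_div_comm, mul_one]
  have h2 : (∑ x ∈ n.divisorsAntidiagonal, (μ x.1 : ℤ) : ℤ) = if n = 1 then 1 else 0 := by
    have := congrArg (fun f : ArithmeticFunction ℤ => f n) ArithmeticFunction.moebius_mul_coe_zeta
    simp only [ArithmeticFunction.mul_apply, ArithmeticFunction.one_apply] at this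
    rw [← this]
    refine Finset.sum_congr rfl fun x hx => ?_
    obtain ⟨h1, h2⟩ := Nat.mem_divisorsAntidiagonal.1 hx
    have : x.2 ≠ 0 := by rintro h; rw [h] at h1; simp at h1; omega
    simp [ArithmeticFunction.zeta_apply, this]
  rw [h1, h2]
  split_ifs with h
  · simp [h]
  · simp

lemma eA_small {q n : ℕ} [NeZero q] (hn : n ≤ q) : eA q n = 0 := by
  rcases eq_or_ne n 0 with rfl | hn0
  · simp
  · have : eA q n = (mA q * pA q) n - (1 : ArithmeticFunction ℝ) n := rfl
    rw [this, mp_small hn0 hn, ArithmeticFunction.one_apply, sub_self]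

lemma eA_le {q n : ℕ} [NeZero q] {K : ℝ} (hK : Kb q K) (hn0 : n ≠ 0) (hn : n ≤ q ^ 5) : |eA q n| ≤ K / n := by
  have hK1 := hK.one_le
  rcases eq_or_ne n 1 with rfl | h1
  · rw [eA_small NeZero.one_le]; simp; linarith
  have : eA q n = (mA q * pA q) n - (1 : ArithmeticFunction ℝ) n := rfl
  rw [this, ArithmeticFunction.one_apply, if_neg h1, sub_zero]
  refine (mul_bound _ _ zero_le_one zero_le_one n (fun x _ => mA_le q x) (fun x _ => pA_le q x)).trans ?_
  gcongr
  simpa using hK.div n hn0 hn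

lemma em_le {q n : ℕ} [NeZero q] {K : ℝ} (hK : Kb q K) (hn0 : n ≠ 0) (hn : n ≤ q ^ 5) : |(eA q * mA q) n| ≤ K ^ 2 / n := by
  have hK1 := hK.one_le
  refine (mul_bound _ _ (A := K) (by linarith) zero_le_one n (fun x hx => ?_) (fun x _ => mA_le q x)).trans ?_
  · have h1 : x ≤ n := Nat.le_of_dvd (by omega) hx
    refine eA_le hK (fun h => ?_) (by omega)
    rw [h] at hx; exact hn0 (Nat.eq_zero_of_zero_dvd hx)
  · gcongr
    have := hK.div n hn0 hn
    nlinarith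

lemma em_small {q n : ℕ} [NeZero q] (hn : n ≤ q) : (eA q * mA q) n = 0 := by
  rw [ArithmeticFunction.mul_apply]
  refine Finset.sum_eq_zero fun x hx => ?_
  obtain ⟨h1, h2⟩ := Nat.mem_divisorsAntidiagonal.1 hx
  have l1 : x.1 ≤ n := Nat.le_of_dvd (by omega) (Dvd.intro _ h1)
  rw [eA_small (by omega), zero_mul]

lemma mA_supp {q n : ℕ} (h : mA q n ≠ 0) : n ≤ q := by
  by_contra h'
  exact h (by rw [mA_apply, if_neg h'])

lemma pA_supp {q n : ℕ} (h : pA q n ≠ 0) : n ≤ q ^ 3 := by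
  by_contra h'
  exact h (by rw [pA_apply, if_neg h'])

lemma mp_supp {q n : ℕ} (h : (mA q * pA q) n ≠ 0) : n ≤ q ^ 4 := by
  rw [ArithmeticFunction.mul_apply] at h
  obtain ⟨x, hx, hne⟩ := Finset.exists_ne_zero_of_sum_ne_zero h
  obtain ⟨h1, h2⟩ := Nat.mem_divisorsAntidiagonal.1 hx
  have := mA_supp (left_ne_zero_of_mul hne)
  have := pA_supp (right_ne_zero_of_mul hne)
  rw [← h1]
  calc _ ≤ q * q ^ 3 := by gcongr
    _ = _ := by ring

lemma eA_supp {q n : ℕ} [NeZero q] (h : eA q n ≠ 0) : n ≤ q ^ 4 := by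
  by_cases h1 : (mA q * pA q) n ≠ 0
  · exact mp_supp h1
  · push Not at h1
    have : eA q n = (mA q * pA q) n - (1 : ArithmeticFunction ℝ) n := rfl
    rw [this, h1, ArithmeticFunction.one_apply] at h
    have hn : n = 1 := by
      by_contra h'
      simp [h'] at h
    rw [hn]; exact Nat.one_le_pow _ _ (NeZero.pos q)

section
variable {q : ℕ} [NeZero q]

noncomputable def MM (χ : DirichletCharacter ℂ q) : ℂ := DD (q ^ 5) (mA q) χ
noncomputable def EE (χ : DirichletCharacter ℂ q) : ℂ := DD (q ^ 5) (eA q) χ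

lemma DD_pA (χ : DirichletCharacter ℂ q) : DD (q ^ 5) (pA q) χ = pS χ 1 (q ^ 3) := by
  unfold DD pS
  have hsub : Finset.Icc 1 (q ^ 3) ⊆ Finset.Icc 1 (q ^ 5) := 
    Finset.Icc_subset_Icc le_rfl (Nat.pow_le_pow_right (NeZero.pos q) (by norm_num))
  rw [← Finset.sum_subset hsub]
  · refine Finset.sum_congr rfl fun n hn => ?_
    rw [pA_apply, if_pos (Finset.mem_Icc.1 hn).2, cpow_neg_one]
    push_cast; rw [one_div, mul_comm]
  · intro n hn hn'
    rw [pA_apply, if_neg]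
    · simp
    · intro h; exact hn' (Finset.mem_Icc.2 ⟨(Finset.mem_Icc.1 hn).1, h⟩)

lemma EE_eq (χ : DirichletCharacter ℂ q) : EE χ = pS χ 1 (q ^ 3) * MM χ - 1 := by
  have hq := NeZero.pos q
  have h1 : EE χ = DD (q ^ 5) (mA q * pA q : ArithmeticFunction ℝ) χ - DD (q ^ 5) (1 : ArithmeticFunction ℝ) χ := by
    unfold EE DD
    rw [← Finset.sum_sub_distrib]
    refine Finset.sum_congr rfl fun n _ => ?_
    have : eA q n = (mA q * pA q) n - (1 : ArithmeticFunction ℝ) n := rfl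
    rw [this]; push_cast; ring
  rw [h1, DD_mul, DD_pA, mul_comm]
  · congr 1
    unfold DD
    rw [Finset.sum_eq_single 1]
    · simp
    · intro n _ hn; simp [ArithmeticFunction.one_apply, hn]
    · intro h; exact absurd (Finset.mem_Icc.2 ⟨le_rfl, Nat.one_le_pow _ _ hq⟩) h
  · intro x y hx hy
    have := mA_supp hx
    have := pA_supp hy
    calc _ ≤ q * q ^ 3 := by gcongr
      _ ≤ q * q ^ 4 := by gcongr <;> omega
      _ = _ := by ring

lemma EM_eq (χ : DirichletCharacter ℂ q) : DD (q ^ 5) (eA q * mA q : ArithmeticFunction ℝ) χ = EE χ * MM χ := by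
  refine DD_mul _ _ _ _ fun x y hx hy => ?_
  have := eA_supp hx
  have := mA_supp hy
  calc _ ≤ q ^ 4 * q := by gcongr
    _ = _ := by ring

lemma DD_norm (Q : ℕ) (a : ℕ → ℝ) {A : ℝ} (ha : ∀ n ∈ Finset.Icc 1 Q, |a n| ≤ A / n) (χ : DirichletCharacter ℂ q) :
    ‖DD Q a χ‖ ≤ A * Hr Q := by
  unfold DD Hr
  rw [Finset.mul_sum]
  refine (norm_sum_le _ _).trans (Finset.sum_le_sum fun n hn => ?_)
  rw [norm_mul, norm_real, Real.norm_eq_abs]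
  have := norm_le_one χ (n : ZMod q)
  have := ha n hn
  calc _ ≤ |a n| * 1 := by gcongr
    _ ≤ _ := by rw [mul_one_div, mul_one]; exact this

variable {K : ℝ}

lemma Hr_K (hK : Kb q K) : Hr (q ^ 5) ≤ K := (Hr_mono (by omega)).trans hK.harm

lemma MM_norm (hK : Kb q K) (χ : DirichletCharacter ℂ q) : ‖MM χ‖ ≤ K := by
  refine (DD_norm _ _ (A := 1) (fun n _ => mA_le q n) χ).trans ?_
  rw [one_mul]; exact Hr_K hK

lemma EE_norm (hK : Kb q K) (χ : DirichletCharacter ℂ q) : ‖EE χ‖ ≤ K ^ 2 := by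
  have hK1 := hK.one_le
  refine (DD_norm _ _ (A := K) (fun n hn => ?_) χ).trans ?_
  · have := Finset.mem_Icc.1 hn
    exact eA_le hK (by omega) this.2
  · rw [sq]; gcongr; exact Hr_K hK

lemma harm_sq (hK : Kb q K) : Hr (2 * q ^ 5) ^ 2 ≤ K ^ 2 := by
  have := Hr_nonneg (2 * q ^ 5)
  have := hK.harm
  gcongr

lemma sum_M (hK : Kb q K) : ‖∑ χ ∈ Ev q, MM χ * (starRingEnd ℂ) (MM χ) -
      ∑ n ∈ Finset.Icc 1 (q ^ 5), ((mA q n * mA q n : ℝ) : ℂ) * W (n : ZMod q) n‖ ≤ 4 * K ^ 2 := by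
  refine (mean_value (q ^ 5) (mA q) (mA q) zero_le_one zero_le_one (fun n _ => mA_le q n) (fun n _ => mA_le q n)).trans ?_
  have := harm_sq hK
  linarith

lemma sum_EM (hK : Kb q K) : ‖∑ χ ∈ Ev q, EE χ * MM χ * (starRingEnd ℂ) (MM χ)‖ ≤ 4 * K ^ 4 := by
  have hK1 := hK.one_le
  have h := mean_value (q ^ 5) (eA q * mA q : ArithmeticFunction ℝ) (mA q) (q := q) (A := K ^ 2) (by positivity) zero_le_one (fun n hn => by
      have := Finset.mem_Icc.1 hn
      exact em_le hK (by omega) this.2) (fun n _ => mA_le q n)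
  have h0 : ∑ n ∈ Finset.Icc 1 (q ^ 5), (((eA q * mA q) n * mA q n : ℝ) : ℂ) * W (n : ZMod q) n = 0 := by
    refine Finset.sum_eq_zero fun n _ => ?_
    rcases le_or_gt n q with h | h
    · rw [em_small h]; simp
    · rw [mA_apply, if_neg (by omega)]; simp
  rw [h0, sub_zero] at h
  simp only [EM_eq] at h
  refine h.trans ?_
  have := harm_sq hK
  calc _ ≤ 4 * (K ^ 2 * 1) * K ^ 2 := by gcongr
    _ = _ := by ring

lemma sum_inv_sq_tail (Q : ℕ) (hq : 0 < q) : ∑ n ∈ (Finset.Icc 1 Q).filter (fun n => q < n), 1 / (n:ℝ) ^ 2 ≤ 1 / (q:ℝ) := by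
  have h1 : (Finset.Icc 1 Q).filter (fun n => q < n) = Finset.Ioc q Q := by
    ext n; simp; omega
  rw [h1]
  rcases le_or_gt q Q with h | h
  · have h2 := sum_Ioc_inv_sq_le_sub (α := ℝ) hq.ne' h
    have : (0:ℝ) ≤ (Q:ℝ)⁻¹ := by positivity
    simp only [one_div]
    linarith
  · rw [Finset.Ioc_eq_empty (by omega)]; simp

lemma sum_E (hK : Kb q K) : ∑ χ ∈ Ev q, ‖EE χ‖ ^ 2 ≤ 5 * K ^ 4 := by
  have hK1 := hK.one_le
  have hq : (0:ℝ) < q := by exact_mod_cast NeZero.pos q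
  have hb : ∀ n ∈ Finset.Icc 1 (q ^ 5), |eA q n| ≤ K / n := fun n hn => by
      have := Finset.mem_Icc.1 hn
      exact eA_le hK (by omega) this.2
  have h := mean_value (q ^ 5) (eA q) (eA q) (q := q) (A := K) (B := K) (by positivity) (by positivity) hb hb
  have hd : ‖∑ n ∈ Finset.Icc 1 (q ^ 5), ((eA q n * eA q n : ℝ) : ℂ) * W (n : ZMod q) n‖ ≤ K ^ 2 := by
    calc _ ≤ ∑ n ∈ Finset.Icc 1 (q ^ 5), (if q < n then K ^ 2 * q * (1 / (n:ℝ) ^ 2) else 0) := by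
          refine (norm_sum_le _ _).trans (Finset.sum_le_sum fun n hn => ?_)
          split_ifs with hnq
          · rw [norm_mul, norm_real, Real.norm_eq_abs, abs_mul]
            calc _ ≤ K / n * (K / n) * q := by
                  gcongr
                  · exact hb n hn
                  · exact hb n hn
                  · exact W_norm_le _ _
              _ = _ := by ring
          · rw [eA_small (by omega)]; simp
      _ = K ^ 2 * q * ∑ n ∈ (Finset.Icc 1 (q ^ 5)).filter (fun n => q < n), 1 / (n:ℝ) ^ 2 := by
          rw [← Finset.sum_filter, Finset.mul_sum]
      _ ≤ K ^ 2 * q * (1 / q) := by gcongr; exact sum_inv_sq_tail _ (NeZero.pos q)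
      _ = _ := by field_simp
  have e : ∑ χ ∈ Ev q, DD (q ^ 5) (eA q) χ * (starRingEnd ℂ) (DD (q ^ 5) (eA q) χ) = ((∑ χ ∈ Ev q, ‖EE χ‖ ^ 2 : ℝ) : ℂ) := by
    push_cast
    refine Finset.sum_congr rfl fun χ _ => ?_
    rw [mul_conj, normSq_eq_norm_sq]; push_cast; rfl
  rw [e] at h
  have h2 := norm_sub_norm_le ((∑ χ ∈ Ev q, ‖EE χ‖ ^ 2 : ℝ) : ℂ) (∑ n ∈ Finset.Icc 1 (q ^ 5), ((eA q n * eA q n : ℝ) : ℂ) * W (n : ZMod q) n)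
  rw [norm_real, Real.norm_eq_abs, abs_of_nonneg (Finset.sum_nonneg fun _ _ => by positivity)] at h2
  have h3 : 4 * (K * K) * Hr (2 * q ^ 5) ^ 2 ≤ 4 * (K * K) * K ^ 2 := mul_le_mul_of_nonneg_left (harm_sq hK) (by positivity)
  have h4 : K ^ 2 ≤ K ^ 4 := pow_le_pow_right₀ hK1 (by norm_num)
  have h5 : 4 * (K * K) * K ^ 2 = 4 * K ^ 4 := by ring
  linarith
end
end NSM


namespace NSM
open Filter Topology
open scoped ArithmeticFunction.Moebius

noncomputable def fZ (q n : ℕ) : ℝ := if n.Coprime q then (μ n : ℝ) ^ 2 / (n:ℝ) ^ 2 else 0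

lemma fZ_nonneg (q n : ℕ) : 0 ≤ fZ q n := by
  unfold fZ; split_ifs <;> positivity

lemma fZ_le (q n : ℕ) : fZ q n ≤ 1 / (n:ℝ) ^ 2 := by
  unfold fZ; split_ifs
  · gcongr
    have : |(μ n : ℝ)| ≤ 1 := by exact_mod_cast ArithmeticFunction.abs_moebius_le_one
    exact (sq_le_one_iff_abs_le_one _).2 this
  · positivity

lemma fZ_summable (q : ℕ) : Summable (fZ q) :=
  Summable.of_nonneg_of_le (fZ_nonneg q) (fZ_le q) (Real.summable_one_div_nat_pow.2 (by norm_num))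

lemma fZ_pos {q n : ℕ} (h : n.Coprime q) : fZ q n = (μ n : ℝ) ^ 2 / (n:ℝ) ^ 2 := by
  unfold fZ; exact if_pos h

lemma fZ_neg {q n : ℕ} (h : ¬ n.Coprime q) : fZ q n = 0 := by
  unfold fZ; exact if_neg h

lemma fZ_mul (q : ℕ) {m n : ℕ} (hmn : m.Coprime n) : fZ q (m * n) = fZ q m * fZ q n := by
  by_cases h1 : m.Coprime q
  · by_cases h2 : n.Coprime q
    · rw [fZ_pos h1, fZ_pos h2, fZ_pos (Nat.Coprime.mul_left h1 h2),
        ArithmeticFunction.isMultiplicative_moebius.map_mul_of_coprime hmn]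
      push_cast; ring
    · rw [fZ_neg h2, fZ_neg (fun h => h2 (Nat.coprime_mul_iff_left.1 h).2), mul_zero]
  · rw [fZ_neg h1, fZ_neg (fun h => h1 (Nat.coprime_mul_iff_left.1 h).1), zero_mul]

lemma fZ_hasProd (q : ℕ) [NeZero q] : HasProd (fun p : Nat.Primes => 1 + (1 : DirichletCharacter ℂ q) ((p:ℕ) : ZMod q) * ((p:ℕ) : ℂ) ^ (-2 : ℂ))
    ((∑' n, fZ q n : ℝ) : ℂ) := by
  have h := EulerProduct.eulerProduct_hasProd (f := fun n => (fZ q n : ℂ)) (by simp [fZ])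
    (by
      intro m n hmn
      rw [fZ_mul q hmn]; push_cast; rfl)
    (by
      have := (fZ_summable q)
      refine this.congr fun n => ?_
      simp [abs_of_nonneg (fZ_nonneg q n)])
    (by simp [fZ])
  rw [ofReal_tsum]
  convert h using 2 with p
  have hp := p.2
  rw [tsum_eq_sum (s := Finset.range 2)]
  · rw [Finset.sum_range_succ, Finset.sum_range_one, pow_zero, pow_one]
    have e1 : fZ q 1 = 1 := by simp [fZ]
    have e2 : (p:ℂ) ^ (-2:ℂ) = 1 / (p:ℂ) ^ 2 := by
      rw [cpow_neg, one_div]; norm_cast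
    rw [e1, e2]
    by_cases hc : (p:ℕ).Coprime q
    · rw [MulChar.one_apply ((ZMod.isUnit_iff_coprime _ _).2 hc)]
      rw [fZ_pos hc, ArithmeticFunction.moebius_apply_prime hp]; simp
    · rw [MulChar.map_nonunit _ (fun h => hc ((ZMod.isUnit_iff_coprime _ _).1 h))]
      rw [fZ_neg hc]; simp
  · intro k hk
    have hk2 : 2 ≤ k := by
      have : 1 < k := by simpa using hk
      omega
    have : ¬ Squarefree ((p:ℕ) ^ k) := by
      intro h
      have := (Nat.squarefree_pow_iff hp.ne_one (by omega)).1 h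
      omega
    simp [fZ, ArithmeticFunction.moebius_eq_zero_of_not_squarefree this]

lemma Z_eq (q : ℕ) [NeZero q] : (riemannZeta 2 / (2 * riemannZeta 4)).re * (∏ p ∈ q.primeFactors, (1 + ((p : ℝ) ^ 2)⁻¹)⁻¹)
    = (∑' n, fZ q n) / 2 := by
  set χ0 : DirichletCharacter ℂ q := 1 with hχ0
  have h1 : HasProd (fun p : Nat.Primes => 1 + χ0 ((p:ℕ) : ZMod q) * ((p:ℕ) : ℂ) ^ (-2 : ℂ))
    ((∑' n, fZ q n : ℝ) : ℂ) := fZ_hasProd q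
  have h2 := LSeries_eulerProduct_hasProd χ0 (s := 2) (by norm_num)
  have h4 := LSeries_eulerProduct_hasProd χ0 (s := 4) (by norm_num)
  have h := h4.mul h1
  have e : ∀ p : Nat.Primes, (1 - χ0 ((p:ℕ) : ZMod q) * ((p:ℕ):ℂ) ^ (-4:ℂ))⁻¹ * (1 + χ0 ((p:ℕ) : ZMod q) * ((p:ℕ):ℂ) ^ (-2:ℂ)) =
     (1 - χ0 ((p:ℕ) : ZMod q) * ((p:ℕ):ℂ) ^ (-2:ℂ))⁻¹ := by
    intro p
    have hp2 : (2:ℝ) ≤ p := by exact_mod_cast p.2.two_le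
    have e4 : ((p:ℕ):ℂ) ^ (-4:ℂ) = (((p:ℕ):ℂ) ^ (-2:ℂ)) ^ 2 := by
      rw [← cpow_nat_mul]; norm_num
    have hn : ‖((p:ℕ):ℂ) ^ (-2:ℂ)‖ ≤ 1 / 4 := by
      have e2 : ((p:ℕ):ℂ) ^ (-2:ℂ) = (((p:ℕ):ℂ)^2)⁻¹ := by
        rw [cpow_neg]; norm_cast
      rw [e2, norm_inv, norm_pow, norm_natCast, one_div]
      gcongr
      nlinarith
    rw [e4]
    set y := ((p:ℕ):ℂ) ^ (-2:ℂ)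
    have hc : χ0 ((p:ℕ) : ZMod q) = 0 ∨ χ0 ((p:ℕ) : ZMod q) = 1 := by
      by_cases hu : IsUnit ((p:ℕ) : ZMod q)
      · right; exact MulChar.one_apply hu
      · left; exact MulChar.map_nonunit _ hu
    rcases hc with hc | hc <;> rw [hc]
    · simp
    · have a1 : 1 - y ≠ 0 := by
        intro h0
        have : y = 1 := (sub_eq_zero.1 h0).symm
        rw [this] at hn; norm_num at hn
      have a2 : 1 + y ≠ 0 := by
        intro h0
        have : y = -1 := by linear_combination h0
        rw [this] at hn; norm_num at hn
      rw [one_mul, one_mul, show 1 - y ^ 2 = (1 - y) * (1 + y) by ring]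
      field_simp
  simp only [e] at h
  have hu := h.unique h2
  rw [← LFunction_eq_LSeries χ0 (by norm_num), ← LFunction_eq_LSeries χ0 (by norm_num)] at hu
  have t2 := LFunctionTrivChar_eq_mul_riemannZeta (N := q) (s := 2) (by norm_num)
  have t4 := LFunctionTrivChar_eq_mul_riemannZeta (N := q) (s := 4) (by norm_num)
  change χ0.LFunction 2 = _ at t2
  change χ0.LFunction 4 = _ at t4
  rw [t2, t4] at hu
  have z4 : riemannZeta 4 ≠ 0 := riemannZeta_ne_zero_of_one_le_re (by norm_num)
  have key : ∀ p ∈ q.primeFactors, (1 - (p:ℂ) ^ (-2:ℂ)) = (1 - (p:ℂ) ^ (-4:ℂ)) * (1 + ((p:ℂ)^2)⁻¹)⁻¹ ∧ (1 - (p:ℂ) ^ (-4:ℂ)) ≠ 0 := by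
    intro p hp
    have hp2 : (2:ℝ) ≤ p := by exact_mod_cast (Nat.prime_of_mem_primeFactors hp).two_le
    have e4 : (p:ℂ) ^ (-4:ℂ) = (((p:ℂ)^2)⁻¹) ^ 2 := by
      rw [cpow_neg]; norm_cast; push_cast; rw [← inv_pow, ← inv_pow, ← pow_mul]
    have e2 : (p:ℂ) ^ (-2:ℂ) = ((p:ℂ)^2)⁻¹ := by
      rw [cpow_neg]; norm_cast
    have hn : ‖((p:ℂ)^2)⁻¹‖ ≤ 1 / 4 := by
      rw [norm_inv, norm_pow, norm_natCast, one_div]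
      gcongr
      nlinarith
    rw [e4, e2]
    set y := ((p:ℂ)^2)⁻¹
    have a1 : 1 - y ≠ 0 := by
      intro h0
      have : y = 1 := (sub_eq_zero.1 h0).symm
      rw [this] at hn; norm_num at hn
    have a2 : 1 + y ≠ 0 := by
      intro h0
      have : y = -1 := by linear_combination h0
      rw [this] at hn; norm_num at hn
    rw [show 1 - y ^ 2 = (1 - y) * (1 + y) by ring]
    exact ⟨by field_simp, mul_ne_zero a1 a2⟩
  rw [Finset.prod_congr rfl (fun p hp => (key p hp).1), Finset.prod_mul_distrib] at hu
  have p4 : ∏ p ∈ q.primeFactors, (1 - (p:ℂ) ^ (-4:ℂ)) ≠ 0 := Finset.prod_ne_zero_iff.2 fun p hp => (key p hp).2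
  set R : ℝ := ∏ p ∈ q.primeFactors, (1 + ((p : ℝ) ^ 2)⁻¹)⁻¹ with hR
  have eR : ∏ p ∈ q.primeFactors, (1 + ((p : ℂ) ^ 2)⁻¹)⁻¹ = (R : ℂ) := by rw [hR]; push_cast; rfl
  rw [eR] at hu
  have fin : riemannZeta 2 / (2 * riemannZeta 4) * (R : ℂ) = (((∑' n, fZ q n) / 2 : ℝ) : ℂ) := by
    push_cast
    push_cast at hu
    have : riemannZeta 4 * (∑' n, (fZ q n : ℂ)) = riemannZeta 2 * R := by
      apply mul_left_cancel₀ p4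
      linear_combination hu
    field_simp
    linear_combination -this
  rw [← re_mul_ofReal, fin, ofReal_re]

lemma Z_tail (q : ℕ) [NeZero q] : |(∑' n, fZ q n) - ∑ n ∈ Finset.Icc 1 q, fZ q n| ≤ 1 / q := by
  have hq := NeZero.pos q
  have h1 : ∑ n ∈ Finset.Icc 1 q, fZ q n ≤ ∑' n, fZ q n := (fZ_summable q).sum_le_tsum _ (fun n _ => fZ_nonneg q n)
  have h2 : ∑' n, fZ q n ≤ ∑ n ∈ Finset.Icc 1 q, fZ q n + 1 / q := by
    refine Real.tsum_le_of_sum_range_le (fZ_nonneg q) fun N => ?_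
    have h0 : ∀ n, fZ q n ≤ (if n ∈ Finset.Icc 1 q then fZ q n else 0) + (if q < n then 1 / (n:ℝ) ^ 2 else 0) := by
      intro n
      by_cases hn : n ∈ Finset.Icc 1 q
      · rw [if_pos hn]
        have : 0 ≤ (if q < n then 1 / (n:ℝ) ^ 2 else 0) := by positivity
        linarith
      · rw [if_neg hn, zero_add]
        rw [Finset.mem_Icc] at hn
        split_ifs with h
        · exact fZ_le q n
        · have : n = 0 := by omega
          simp [this, fZ]
    refine (Finset.sum_le_sum fun n _ => h0 n).trans ?_
    rw [Finset.sum_add_distrib]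
    refine add_le_add ?_ ?_
    · rw [← Finset.sum_filter]
      refine Finset.sum_le_sum_of_subset_of_nonneg ?_ (fun n _ _ => fZ_nonneg q n)
      intro n hn; exact (Finset.mem_filter.1 hn).2
    · rw [← Finset.sum_filter]
      refine le_trans ?_ (sum_inv_sq_tail N hq)
      refine Finset.sum_le_sum_of_subset_of_nonneg ?_ (fun n _ _ => by positivity)
      intro n hn
      have := Finset.mem_filter.1 hn
      simp at this
      simp; omega
  rw [abs_le]
  have : (0:ℝ) ≤ 1 / q := by positivity
  constructor <;> linarith

lemma diag_eq (q : ℕ) [NeZero q] (hq : 3 ≤ q) : ∑ n ∈ Finset.Icc 1 (q ^ 5), ((mA q n * mA q n : ℝ) : ℂ) * W (n : ZMod q) n =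
    (((q.totient : ℝ) / 2 * ∑ n ∈ Finset.Icc 1 q, fZ q n : ℝ) : ℂ) := by
  have hsub : Finset.Icc 1 q ⊆ Finset.Icc 1 (q ^ 5) := 
    Finset.Icc_subset_Icc le_rfl (Nat.le_self_pow (by norm_num) q)
  rw [← Finset.sum_subset hsub]
  · push_cast
    rw [Finset.mul_sum]
    refine Finset.sum_congr rfl fun n hn => ?_
    rw [W_diag hq, mA_apply, if_pos (Finset.mem_Icc.1 hn).2, fZ]
    split_ifs
    · push_cast; ring
    · simp
  · intro n hn hn'
    rw [mA_apply, if_neg]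
    · simp
    · intro h; exact hn' (Finset.mem_Icc.2 ⟨(Finset.mem_Icc.1 hn).1, h⟩)

end NSM


namespace NSM
open Filter Topology

lemma point_alg {K : ℝ} (hK : 1 ≤ K) (L M : ℂ) (h0 : L ≠ 0) (hL : ‖L‖ ≤ K) (hL' : ‖L‖⁻¹ ≤ K) (hM : ‖M‖ ≤ K) :
    |1 / ‖L‖ ^ 2 - ‖M‖ ^ 2 * (1 - 2 * (L * M - 1).re)| ≤ 7 * K ^ 4 * ‖L * M - 1‖ ^ 2 := by
  set x := L * M - 1 with hx
  have hLpos : 0 < ‖L‖ := norm_pos_iff.2 h0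
  have hxn : ‖x‖ ≤ 2 * K ^ 2 := by
    calc ‖x‖ ≤ ‖L * M‖ + ‖(1:ℂ)‖ := norm_sub_le _ _
      _ ≤ K * K + 1 := by rw [norm_mul, norm_one]; gcongr
      _ ≤ 2 * K ^ 2 := by nlinarith
  have hn : ‖L‖ ^ 2 * ‖M‖ ^ 2 = 1 + 2 * x.re + ‖x‖ ^ 2 := by
    have : L * M = 1 + x := by rw [hx]; ring
    rw [← mul_pow, ← norm_mul, this, ← normSq_eq_norm_sq, ← normSq_eq_norm_sq, normSq_apply, normSq_apply]
    simp; ring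
  have hr : x.re ^ 2 ≤ ‖x‖ ^ 2 := by
    rw [← normSq_eq_norm_sq, normSq_apply]; nlinarith [mul_self_nonneg x.im]
  have hr1 : |x.re| ≤ 2 * K ^ 2 := (abs_re_le_norm x).trans hxn
  have hM2 : ‖M‖ ^ 2 = (‖L‖⁻¹) ^ 2 * (1 + 2 * x.re + ‖x‖ ^ 2) := by
    rw [← hn]; field_simp
  have e : 1 / ‖L‖ ^ 2 - ‖M‖ ^ 2 * (1 - 2 * x.re) =
      (‖L‖⁻¹) ^ 2 * (4 * x.re ^ 2 - ‖x‖ ^ 2 + 2 * x.re * ‖x‖ ^ 2) := by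
    rw [hM2, one_div, ← inv_pow]; ring
  rw [e, abs_mul, abs_of_nonneg (by positivity : 0 ≤ (‖L‖⁻¹) ^ 2)]
  have hK2 : 1 ≤ K ^ 2 := one_le_pow₀ hK
  have hb : |4 * x.re ^ 2 - ‖x‖ ^ 2 + 2 * x.re * ‖x‖ ^ 2| ≤ 7 * K ^ 2 * ‖x‖ ^ 2 := by
    have s0 : 0 ≤ ‖x‖ ^ 2 := by positivity
    have hr2 := abs_le.1 hr1
    have i1 : x.re * ‖x‖ ^ 2 ≤ 2 * K ^ 2 * ‖x‖ ^ 2 := by gcongr; exact hr2.2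
    have i2 : -(2 * K ^ 2) * ‖x‖ ^ 2 ≤ x.re * ‖x‖ ^ 2 := by gcongr; exact hr2.1
    have i3 : ‖x‖ ^ 2 ≤ K ^ 2 * ‖x‖ ^ 2 := le_mul_of_one_le_left s0 hK2
    rw [abs_le]
    constructor <;> nlinarith [sq_nonneg x.re]
  calc (‖L‖⁻¹) ^ 2 * |4 * x.re ^ 2 - ‖x‖ ^ 2 + 2 * x.re * ‖x‖ ^ 2| ≤ K ^ 2 * (7 * K ^ 2 * ‖x‖ ^ 2) := by
        gcongr
    _ = _ := by ring

variable {q : ℕ} [NeZero q] {K : ℝ}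

lemma point (hK : Kb q K) (χ : DirichletCharacter ℂ q) (hχ : χ ≠ 1) :
    |1 / ‖χ.LFunction 1‖ ^ 2 - ‖MM χ‖ ^ 2 * (1 - 2 * (EE χ).re)| ≤ 14 * K ^ 4 * ‖EE χ‖ ^ 2 + 232 * K ^ 6 / q := by
  have hK1 := hK.one_le
  have hq1 : (1:ℝ) ≤ q := by exact_mod_cast NeZero.pos q
  have hM := MM_norm hK χ
  have h := point_alg hK1 (χ.LFunction 1) (MM χ) (LFunction_apply_one_ne_zero hχ) (hK.up χ hχ) (hK.low χ hχ) hM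
  set L := χ.LFunction 1
  set M := MM χ
  set x := L * M - 1 with hx
  set E := EE χ with hE
  have hd : ‖x - E‖ ≤ 4 * K / q := by
    have e : x - E = (L - pS χ 1 (q ^ 3)) * M := by rw [hx, hE, EE_eq]; ring
    have hp := LFunction_sub_pS χ hχ (s := 1) (by simp) (N := q ^ 3) (Nat.one_le_pow _ _ (NeZero.pos q))
    have hp2 : ‖L - pS χ 1 (q ^ 3)‖ ≤ 4 / q := by
      refine hp.trans ?_
      simp only [one_re, norm_one, Real.rpow_neg_one]
      push_cast
      rw [div_one, show 2 * (q:ℝ) * (1 + 1) * ((q:ℝ) ^ 3)⁻¹ = 4 / (q:ℝ) ^ 2 by field_simp; norm_num]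
      gcongr
      nlinarith
    rw [e, norm_mul]
    calc _ ≤ 4 / q * K := by gcongr
      _ = _ := by ring
  have hx2 : ‖x‖ ^ 2 ≤ 2 * ‖E‖ ^ 2 + 32 * K ^ 2 / q := by
    have h1 : ‖x‖ ≤ ‖E‖ + 4 * K / q := by
      calc ‖x‖ = ‖E + (x - E)‖ := by congr 1; ring
        _ ≤ _ := (norm_add_le _ _).trans (by gcongr)
    have h2 : ‖x‖ ^ 2 ≤ (‖E‖ + 4 * K / q) ^ 2 := by gcongr
    have h3 : (4 * K / q) ^ 2 ≤ 16 * K ^ 2 / q := by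
      rw [div_pow, mul_pow]; norm_num
      gcongr; nlinarith
    have h4 : 2 * (16 * K ^ 2 / q) = 32 * K ^ 2 / q := by ring
    nlinarith [sq_nonneg (‖E‖ - 4 * K / q)]
  have hre : |x.re - E.re| ≤ 4 * K / q := by
    rw [← sub_re]; exact (abs_re_le_norm _).trans hd
  have e : 1 / ‖L‖ ^ 2 - ‖M‖ ^ 2 * (1 - 2 * E.re) =
    (1 / ‖L‖ ^ 2 - ‖M‖ ^ 2 * (1 - 2 * x.re)) + ‖M‖ ^ 2 * (2 * (E.re - x.re)) := by ring
  rw [e]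
  refine (abs_add_le _ _).trans ?_
  have h5 : |‖M‖ ^ 2 * (2 * (E.re - x.re))| ≤ 8 * K ^ 6 / q := by
    rw [abs_mul, abs_mul, abs_sub_comm, abs_of_nonneg (by positivity : 0 ≤ ‖M‖ ^ 2)]
    calc _ ≤ K ^ 2 * (2 * (4 * K / q)) := by gcongr; norm_num
      _ = 8 * K ^ 3 / q := by ring
      _ ≤ 8 * K ^ 6 / q := by gcongr <;> norm_num
  calc _ ≤ 7 * K ^ 4 * (2 * ‖E‖ ^ 2 + 32 * K ^ 2 / q) + 8 * K ^ 6 / q := by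
        refine add_le_add (h.trans ?_) h5
        gcongr
    _ = _ := by ring

lemma card_Ev : ((Ev q).card : ℝ) ≤ q := by
  have h := W_norm_le (1 : ZMod q) 1
  have : W (1 : ZMod q) 1 = ((Ev q).card : ℂ) := by simp [W]
  rwa [this, norm_natCast] at h

lemma one_mem_Ev : (1 : DirichletCharacter ℂ q) ∈ Ev q := by
  classical
  unfold Ev
  rw [Finset.mem_filter]
  refine ⟨Finset.mem_univ _, ?_⟩
  exact MulChar.one_apply isUnit_one.neg

open Classical in
lemma assembly (hK : Kb q K) (hq : 3 ≤ q) :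
    |(∑ χ ∈ (Ev q).erase 1, 1 / ‖χ.LFunction 1‖ ^ 2) - (riemannZeta 2 / (2 * riemannZeta 4)).re *
          (∏ p ∈ q.primeFactors, (1 + ((p : ℝ) ^ 2)⁻¹)⁻¹) * q.totient| ≤ 400 * K ^ 8 := by
  have hK1 := hK.one_le
  have hq1 : (0:ℝ) < q := by exact_mod_cast NeZero.pos q
  rw [Z_eq]
  have hcard : (((Ev q).erase 1).card : ℝ) ≤ q :=
    le_trans (by exact_mod_cast Finset.card_erase_le) card_Ev
  have s1 : |∑ χ ∈ (Ev q).erase 1, (1 / ‖χ.LFunction 1‖ ^ 2 - ‖MM χ‖ ^ 2 * (1 - 2 * (EE χ).re))| ≤ 302 * K ^ 8 := by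
    refine (Finset.abs_sum_le_sum_abs _ _).trans ?_
    refine (Finset.sum_le_sum fun χ hχ => point hK χ (Finset.ne_of_mem_erase hχ)).trans ?_
    rw [Finset.sum_add_distrib, ← Finset.mul_sum, Finset.sum_const, nsmul_eq_mul]
    have h1 : ∑ χ ∈ (Ev q).erase 1, ‖EE χ‖ ^ 2 ≤ 5 * K ^ 4 :=
      (Finset.sum_le_sum_of_subset_of_nonneg (Finset.erase_subset _ _) (fun _ _ _ => by positivity)).trans (sum_E hK)
    have h2 : (((Ev q).erase 1).card : ℝ) * (232 * K ^ 6 / q) ≤ 232 * K ^ 8 := by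
      calc _ ≤ q * (232 * K ^ 6 / q) := by gcongr
        _ = 232 * K ^ 6 := by field_simp
        _ ≤ _ := by gcongr; norm_num
    have h3 : 14 * K ^ 4 * ∑ χ ∈ (Ev q).erase 1, ‖EE χ‖ ^ 2 ≤ 14 * K ^ 4 * (5 * K ^ 4) := by gcongr
    nlinarith
  have s2 : |‖MM (1 : DirichletCharacter ℂ q)‖ ^ 2 * (1 - 2 * (EE (1 : DirichletCharacter ℂ q)).re)| ≤ 3 * K ^ 8 := by
    have h1 : ‖MM (1 : DirichletCharacter ℂ q)‖ ^ 2 ≤ K ^ 2 := by gcongr; exact MM_norm hK _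
    have h2 : |(1 - 2 * (EE (1 : DirichletCharacter ℂ q)).re)| ≤ 3 * K ^ 2 := by
      have := abs_le.1 ((abs_re_le_norm _).trans (EE_norm hK (1 : DirichletCharacter ℂ q)))
      have : 1 ≤ K ^ 2 := one_le_pow₀ hK1
      rw [abs_le]; constructor <;> linarith
    rw [abs_mul, abs_of_nonneg (by positivity : 0 ≤ ‖MM (1 : DirichletCharacter ℂ q)‖ ^ 2)]
    calc _ ≤ K ^ 2 * (3 * K ^ 2) := by gcongr
      _ = 3 * K ^ 4 := by ring
      _ ≤ _ := by gcongr; norm_num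
  have s3 : |∑ χ ∈ Ev q, ‖MM χ‖ ^ 2 * (EE χ).re| ≤ 4 * K ^ 8 := by
    have h := (abs_re_le_norm _).trans (sum_EM hK)
    rw [re_sum] at h
    have e : ∀ χ ∈ Ev q, (EE χ * MM χ * (starRingEnd ℂ) (MM χ)).re = ‖MM χ‖ ^ 2 * (EE χ).re := by
      intro χ _
      rw [mul_assoc, mul_conj, normSq_eq_norm_sq, re_mul_ofReal, mul_comm]
    rw [Finset.sum_congr rfl e] at h
    refine h.trans ?_
    gcongr; norm_num
  have s4 : |∑ χ ∈ Ev q, ‖MM χ‖ ^ 2 - (q.totient : ℝ) / 2 * ∑ n ∈ Finset.Icc 1 q, fZ q n| ≤ 4 * K ^ 8 := by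
    have h := (abs_re_le_norm _).trans (sum_M hK)
    rw [diag_eq q hq, sub_re, re_sum, ofReal_re] at h
    have e : ∀ χ ∈ Ev q, (MM χ * (starRingEnd ℂ) (MM χ)).re = ‖MM χ‖ ^ 2 := by
      intro χ _
      rw [mul_conj, normSq_eq_norm_sq, ofReal_re]
    rw [Finset.sum_congr rfl e] at h
    refine h.trans ?_
    gcongr; norm_num
  have s5 : |(q.totient : ℝ) / 2 * ((∑' n, fZ q n) - ∑ n ∈ Finset.Icc 1 q, fZ q n)| ≤ K ^ 8 := by
    have ht : (q.totient : ℝ) ≤ q := by exact_mod_cast Nat.totient_le q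
    have : 1 ≤ K ^ 8 := one_le_pow₀ hK1
    rw [abs_mul, abs_of_nonneg (by positivity : 0 ≤ (q.totient : ℝ) / 2)]
    calc _ ≤ (q : ℝ) / 2 * (1 / q) := by gcongr; exact Z_tail q
      _ = 1 / 2 := by field_simp
      _ ≤ _ := by linarith
  have e1 : ∑ χ ∈ Ev q, ‖MM χ‖ ^ 2 * (1 - 2 * (EE χ).re) = ∑ χ ∈ Ev q, ‖MM χ‖ ^ 2 - 2 * ∑ χ ∈ Ev q, ‖MM χ‖ ^ 2 * (EE χ).re := by
    rw [Finset.mul_sum, ← Finset.sum_sub_distrib]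
    exact Finset.sum_congr rfl fun χ _ => by ring
  rw [← Finset.sum_erase_add _ _ one_mem_Ev] at e1
  rw [Finset.sum_sub_distrib] at s1
  rw [abs_le] at *
  have : 0 ≤ K ^ 8 := by positivity
  constructor <;> linarith [s1.1, s1.2, s2.1, s2.2, s3.1, s3.2, s4.1, s4.2, s5.1, s5.2]

open Classical in
lemma final : ∀ ε > (0 : ℝ), ∃ C > (0 : ℝ), ∀ (q : ℕ) [NeZero q], 3 ≤ q →
      |(∑ χ : DirichletCharacter ℂ q,
          if χ ≠ 1 ∧ χ.Even then 1 / ‖χ.LFunction 1‖ ^ 2 else 0) -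
        (riemannZeta 2 / (2 * riemannZeta 4)).re *
          (∏ p ∈ q.primeFactors, (1 + ((p : ℝ) ^ 2)⁻¹)⁻¹) * q.totient| ≤
      C * (q : ℝ) ^ ε := by
  intro ε hε
  obtain ⟨C, hC, h⟩ := exists_Kb (η := ε / 8) (by positivity)
  refine ⟨400 * C ^ 8, by positivity, fun q _ hq => ?_⟩
  have ha := assembly (h q) hq
  have e : (∑ χ : DirichletCharacter ℂ q, if χ ≠ 1 ∧ χ.Even then 1 / ‖χ.LFunction 1‖ ^ 2 else 0) =
      ∑ χ ∈ (Ev q).erase 1, 1 / ‖χ.LFunction 1‖ ^ 2 := by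
    rw [← Finset.sum_filter]
    refine Finset.sum_congr ?_ fun _ _ => rfl
    ext χ
    simp [Ev]
  rw [e]
  refine ha.trans (le_of_eq ?_)
  rw [mul_pow, ← Real.rpow_natCast ((q:ℝ) ^ (ε / 8)), ← Real.rpow_mul (by positivity)]
  push_cast
  rw [div_mul_cancel₀ ε (by norm_num : (8:ℝ) ≠ 0)]
  ring

end NSM


open scoped Classical in
/-- For every `ε > 0` there is `C(ε) > 0` such that for every integer `q ≥ 3`,
`|Σ_{χ ≠ χ0, χ even} |L(1,χ)|⁻² − (ζ(2)/(2ζ(4))) ∏_{p ∣ q} (1+p⁻²)⁻¹ φ(q)| ≤ C(ε) qᵉ`. -/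
theorem negative_square_moment_even_Siegel :
    ∀ ε > (0 : ℝ), ∃ C > (0 : ℝ), ∀ (q : ℕ) [NeZero q], 3 ≤ q →
      |(∑ χ : DirichletCharacter ℂ q,
          if χ ≠ 1 ∧ χ.Even then 1 / ‖χ.LFunction 1‖ ^ 2 else 0) -
        (riemannZeta 2 / (2 * riemannZeta 4)).re *
          (∏ p ∈ q.primeFactors, (1 + ((p : ℝ) ^ 2)⁻¹)⁻¹) * q.totient| ≤
      C * (q : ℝ) ^ ε := by
  exact NSM.final
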